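/- Let n ≥ 5 be odd, let k ≥ 1 be an integer, let V : ℝⁿ → ℝ be measurable with |V(x)| ≤ C₀⟨x⟩^{−(n+3)/2−ε} for some ε > 0, and let χ : ℝ → ℝ be a smooth function with χ(λ) = 1 for λ ≤ λ₁/2 and χ(λ) = 0 for λ ≥ λ₁, where 0 < λ₁ ≤ 1 is fixed. For ± ∈ {+, −}, 0 < λ ≤ 1 and x, y ∈ ℝⁿ define the k-th Born series kernel K_k^{±}(λ; x, y) = ∫_{ℝ^{kn}} [ Π_{j=0}^{k} g_n(±λ, |z_j − z_{j+1}|) ] · Π_{j=1}^{k} V(z_j) dz₁ ⋯ dz_k, where z₀ = x and z_{k+1} = y. Then these integrals converge absolutely for a.e. (x, y), and there is a constant C (depending on n, k, V, χ) such that for all real t ≠ 0: sup_{x, y ∈ ℝⁿ} | ∫₀^∞ e^{i t λ²} λ χ(λ) [ K_k^{+}(λ; x, y) − K_k^{−}(λ; x, y) ] dλ | ≤ C |t|^{−n/2}. -/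

import Mathlib

open MeasureTheory Complex Real Finset

/-- The Green's function constant `c₀(n) = Γ(n/2 − 1)/(4 π^{n/2})`. -/
noncomputable def green0 (n : ℕ) : ℝ :=
  Real.Gamma ((n : ℝ) / 2 - 1) / (4 * Real.pi ^ ((n : ℝ) / 2))

/-- The constant `C_n = c₀(n) · ((n−3)/2)!/(n−3)!`. -/
noncomputable def resC (n : ℕ) : ℝ :=
  green0 n * (Nat.factorial ((n - 3) / 2)) / (Nat.factorial (n - 3))

/-- The kernel `g_n(λ, r)` of the limiting free resolvent `(−Δ − λ² − i0)^{−1}` on `ℝ^n`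
for odd `n ≥ 3`. -/
noncomputable def gker (n : ℕ) (lam r : ℝ) : ℂ :=
  (resC n : ℂ) * Complex.exp (Complex.I * (lam : ℂ) * (r : ℂ)) / (r : ℂ) ^ (n - 2) *
    ∑ l ∈ Finset.range ((n - 3) / 2 + 1),
      ((Nat.factorial (n - 3 - l) : ℂ) /
          ((Nat.factorial l : ℂ) * (Nat.factorial ((n - 3) / 2 - l) : ℂ))) *
        ((-2) * Complex.I * (r : ℂ) * (lam : ℂ)) ^ l


/-- The chain of points `x = p₀, z₁, …, z_k, p_{k+1} = y` used in the Born series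
kernel: `p 0 = x`, `p j = z_j` for `1 ≤ j ≤ k`, and `p j = y` otherwise. -/
noncomputable def chainPt {n m : ℕ} (x y : EuclideanSpace ℝ (Fin n))
    (z : Fin m → EuclideanSpace ℝ (Fin n)) (j : ℕ) : EuclideanSpace ℝ (Fin n) :=
  if j = 0 then x else if h : j - 1 < m then z ⟨j - 1, h⟩ else y

/-- The integrand of the `k`-th Born series kernel:
`[∏_{j=0}^{k} g_n(λ, |z_j − z_{j+1}|)] ∏_{j=1}^{k} V(z_j)` with `z₀ = x`, `z_{k+1} = y`. -/
noncomputable def bornIntegrand (n k : ℕ) (V : EuclideanSpace ℝ (Fin n) → ℝ) (lam : ℝ)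
    (x y : EuclideanSpace ℝ (Fin n)) (z : Fin k → EuclideanSpace ℝ (Fin n)) : ℂ :=
  (∏ j ∈ Finset.range (k + 1), gker n lam ‖chainPt x y z j - chainPt x y z (j + 1)‖) *
    ∏ j : Fin k, (V (z j) : ℂ)

/-- The `k`-th Born series kernel `K_k^{±}(λ; x, y)`; the sign is encoded by the sign
of the spectral parameter `λ`. -/
noncomputable def bornKernel (n k : ℕ) (V : EuclideanSpace ℝ (Fin n) → ℝ) (lam : ℝ)
    (x y : EuclideanSpace ℝ (Fin n)) : ℂ :=
  ∫ z : Fin k → EuclideanSpace ℝ (Fin n), bornIntegrand n k V lam x y z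

/-- Uniform bound for the partial Fresnel integrals over intervals starting at `1`. -/
lemma norm_fresnel_one_le (x : ℝ) (hx : 1 ≤ x) :
    ‖∫ u in (1 : ℝ)..x, Complex.exp (I * (u : ℂ) ^ 2)‖ ≤ 2 := by
  have hpos : ∀ u ∈ Set.uIcc 1 x, (0 : ℝ) < u := by
    intro u hu
    rw [Set.uIcc_of_le hx] at hu
    linarith [hu.1]
  have hne : ∀ u ∈ Set.uIcc 1 x, (u : ℂ) ≠ 0 := fun u hu => by
    exact_mod_cast (hpos u hu).ne'
  have hd1 : ∀ u ∈ Set.uIcc 1 x, HasDerivAt (fun u : ℝ => ((2 * I * (u : ℂ))⁻¹))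
      (-(2 * I) / (2 * I * (u : ℂ)) ^ 2) u := by
    intro u hu
    have h1 : HasDerivAt (fun u : ℝ => 2 * I * (u : ℂ)) (2 * I) u := by
      simpa using (Complex.ofRealCLM.hasDerivAt (x := u)).const_mul (2 * I)
    exact h1.inv (by simpa using hne u hu)
  have hd2 : ∀ u ∈ Set.uIcc 1 x, HasDerivAt (fun u : ℝ => Complex.exp (I * (u : ℂ) ^ 2))
      (2 * I * u * Complex.exp (I * (u : ℂ) ^ 2)) u := by
    intro u _
    have h1 : HasDerivAt (fun u : ℝ => I * (u : ℂ) ^ 2) (I * (2 * u)) u := by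
      simpa using ((Complex.ofRealCLM.hasDerivAt (x := u)).pow 2).const_mul I
    convert h1.cexp using 1
    ring
  have hc1 : ContinuousOn (fun u : ℝ => -(2 * I) / (2 * I * (u : ℂ)) ^ 2) (Set.uIcc 1 x) := by
    refine ContinuousOn.div (by fun_prop) (by fun_prop) fun u hu => ?_
    simpa using hne u hu
  have key := intervalIntegral.integral_mul_deriv_eq_deriv_mul hd1 hd2
    hc1.intervalIntegrable (Continuous.intervalIntegrable (by fun_prop) _ _)
  have e1 : ∫ u in (1 : ℝ)..x, Complex.exp (I * (u : ℂ) ^ 2) =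
      ∫ u in (1 : ℝ)..x, (2 * I * (u : ℂ))⁻¹ * (2 * I * u * Complex.exp (I * (u : ℂ) ^ 2)) := by
    refine intervalIntegral.integral_congr fun u hu => ?_
    have := hne u hu
    have hI := I_ne_zero
    field_simp
  have hexp : ∀ u : ℝ, ‖Complex.exp (I * (u : ℂ) ^ 2)‖ = 1 := fun u => by
    rw [mul_comm]
    exact_mod_cast Complex.norm_exp_ofReal_mul_I (u ^ (2 : ℕ))
  have h_int : ‖∫ u in (1 : ℝ)..x, -(2 * I) / (2 * I * (u : ℂ)) ^ 2 *
      Complex.exp (I * (u : ℂ) ^ 2)‖ ≤ ∫ u in (1 : ℝ)..x, (1 / 2) * (u ^ 2)⁻¹ := by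
    refine intervalIntegral.norm_integral_le_of_norm_le hx ?_ ?_
    · refine Filter.Eventually.of_forall fun u hu => ?_
      rw [norm_mul, hexp]
      simp
      apply le_of_eq
      rw [abs_of_pos (by linarith [hu.1])]
      ring
    · refine ContinuousOn.intervalIntegrable ?_
      refine ContinuousOn.mul (by fun_prop) (ContinuousOn.inv₀ (by fun_prop) fun u hu => ?_)
      have := hpos u hu
      positivity
  have hval : ∫ u in (1 : ℝ)..x, (1 / 2) * (u ^ 2)⁻¹ = (1 / 2) * (1 - x⁻¹) := by
    have : ∀ u ∈ Set.uIcc 1 x, HasDerivAt (fun u : ℝ => (1 / 2) * (1 - u⁻¹))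
        ((1 / 2) * (u ^ 2)⁻¹) u := by
      intro u hu
      have := (((hasDerivAt_inv (hpos u hu).ne').const_sub 1).const_mul (1 / 2 : ℝ))
      simpa using this
    rw [intervalIntegral.integral_eq_sub_of_hasDerivAt this]
    · simp
    · refine ContinuousOn.intervalIntegrable ?_
      refine ContinuousOn.mul (by fun_prop) (ContinuousOn.inv₀ (by fun_prop) fun u hu => ?_)
      have := hpos u hu
      positivity
  have hxi : x⁻¹ ≤ 1 := inv_le_one_of_one_le₀ hx
  have hxi0 : 0 ≤ x⁻¹ := by positivity
  rw [e1, key]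
  refine (norm_sub_le _ _).trans ?_
  have hb : ‖(2 * I * (x : ℂ))⁻¹ * Complex.exp (I * (x : ℂ) ^ 2) -
      (2 * I * ((1 : ℝ) : ℂ))⁻¹ * Complex.exp (I * ((1 : ℝ) : ℂ) ^ 2)‖ ≤ 1 := by
    refine (norm_sub_le _ _).trans ?_
    rw [norm_mul, norm_mul, hexp, hexp]
    have : |x|⁻¹ ≤ 1 := by rwa [abs_of_pos (by linarith)]
    simp
    linarith
  linarith

/-- The partial Fresnel integrals are uniformly bounded. -/
lemma norm_fresnel_le (a b : ℝ) : ‖∫ u in a..b, Complex.exp (I * (u : ℂ) ^ 2)‖ ≤ 6 := by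
  have hexp : ∀ u : ℝ, ‖Complex.exp (I * (u : ℂ) ^ 2)‖ = 1 := fun u => by
    rw [mul_comm]
    exact_mod_cast Complex.norm_exp_ofReal_mul_I (u ^ (2 : ℕ))
  have hii : ∀ a b : ℝ, IntervalIntegrable (fun u : ℝ => Complex.exp (I * (u : ℂ) ^ 2))
      volume a b := fun a b => Continuous.intervalIntegrable (by fun_prop) _ _
  have h0 : ∀ x : ℝ, 0 ≤ x → ‖∫ u in (0 : ℝ)..x, Complex.exp (I * (u : ℂ) ^ 2)‖ ≤ 3 := by
    intro x hx
    have hs : ∀ y : ℝ, 0 ≤ y → y ≤ 1 →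
        ‖∫ u in (0 : ℝ)..y, Complex.exp (I * (u : ℂ) ^ 2)‖ ≤ 1 := by
      intro y hy hy1
      refine (intervalIntegral.norm_integral_le_of_norm_le_const (C := 1)
        fun u _ => (hexp u).le).trans ?_
      rw [sub_zero, abs_of_nonneg hy]
      linarith
    rcases le_total x 1 with h | h
    · exact (hs x hx h).trans (by norm_num)
    · rw [← intervalIntegral.integral_add_adjacent_intervals (hii 0 1) (hii 1 x)]
      refine (norm_add_le _ _).trans ?_
      linarith [hs 1 zero_le_one le_rfl, norm_fresnel_one_le x h]
  have h1 : ∀ x : ℝ, ‖∫ u in (0 : ℝ)..x, Complex.exp (I * (u : ℂ) ^ 2)‖ ≤ 3 := by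
    intro x
    rcases le_total 0 x with h | h
    · exact h0 x h
    · have := intervalIntegral.integral_comp_neg (a := 0) (b := x)
        (fun u : ℝ => Complex.exp (I * (u : ℂ) ^ 2))
      simp only [ofReal_neg, neg_sq, neg_zero] at this
      rw [this, intervalIntegral.integral_symm, norm_neg]
      exact h0 (-x) (by linarith)
  rw [← intervalIntegral.integral_interval_sub_left (hii 0 b) (hii 0 a)]
  refine (norm_sub_le _ _).trans ?_
  linarith [h1 a, h1 b]

/-- Van der Corput bound for a quadratic phase, uniform in the linear part and the interval. -/
lemma norm_integral_quadratic_phase_le (t : ℝ) (ht : t ≠ 0) (ρ a b : ℝ) :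
    ‖∫ u in a..b, Complex.exp (I * ((t * u ^ 2 + ρ * u : ℝ) : ℂ))‖ ≤ 6 / √|t| := by
  have hpos : ∀ t : ℝ, 0 < t → ∀ ρ : ℝ,
      ‖∫ u in a..b, Complex.exp (I * ((t * u ^ 2 + ρ * u : ℝ) : ℂ))‖ ≤ 6 / √t := by
    intro t ht ρ
    have hs : 0 < √t := Real.sqrt_pos.2 ht
    have hsq : √t ^ 2 = t := Real.sq_sqrt ht.le
    have e : ∀ u : ℝ, Complex.exp (I * ((t * u ^ 2 + ρ * u : ℝ) : ℂ)) =
        Complex.exp (((-(ρ / (2 * √t)) ^ 2 : ℝ) : ℂ) * I) *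
          Complex.exp (I * ((√t * u + ρ / (2 * √t) : ℝ) : ℂ) ^ 2) := by
      intro u
      rw [← Complex.exp_add, ← ofReal_pow, mul_comm _ I, ← mul_add, ← ofReal_add]
      congr 3
      field_simp
      rw [hsq]
      ring
    simp_rw [e]
    rw [intervalIntegral.integral_const_mul, norm_mul, Complex.norm_exp_ofReal_mul_I, one_mul,
      intervalIntegral.integral_comp_mul_add (fun u : ℝ => Complex.exp (I * (u : ℂ) ^ 2)) hs.ne',
      norm_smul, norm_inv, Real.norm_of_nonneg hs.le, div_eq_inv_mul (6 : ℝ)]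
    exact mul_le_mul_of_nonneg_left (norm_fresnel_le _ _) (inv_nonneg.2 hs.le)
  rcases lt_or_gt_of_ne ht with h | h
  · have := hpos (-t) (by linarith) (-ρ)
    rw [abs_of_neg h]
    refine le_trans (le_of_eq ?_) this
    rw [← RCLike.norm_conj, ← intervalIntegral.intervalIntegral_conj]
    congr 2
    ext u
    rw [← Complex.exp_conj]
    simp only [map_mul, conj_I, conj_ofReal]
    push_cast
    ring_nf
  · rw [abs_of_pos h]
    exact hpos t h ρ

/-- `h` is an amplitude on `(0, 2)` whose oscillatory integrals against every quadratic phase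
`t λ² + ρ λ` over `(0, a)` are bounded by `M |t|^{-1/2}`. -/
structure OscBound (h : ℝ → ℂ) (M : ℝ) : Prop where
  cont : ContinuousOn h (Set.Ioo 0 2)
  int : IntervalIntegrable h volume 0 2
  bound : ∀ t : ℝ, t ≠ 0 → ∀ ρ : ℝ, ∀ a ∈ Set.Icc (0 : ℝ) 2,
    ‖∫ u in (0 : ℝ)..a, Complex.exp (I * ((t * u ^ 2 + ρ * u : ℝ) : ℂ)) * h u‖ ≤ M / √|t|

/-- Multiplication by `f` maps oscillatory amplitudes to oscillatory amplitudes, with norm at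
most `B`. -/
def OscMul (f : ℝ → ℂ) (B : ℝ) : Prop :=
  ∀ h M, OscBound h M → OscBound (fun u => f u * h u) (B * M)

lemma OscBound.nonneg {h : ℝ → ℂ} {M : ℝ} (hh : OscBound h M) : 0 ≤ M := by
  have := hh.bound 1 one_ne_zero 0 0 (by simp)
  simpa using this

lemma OscBound.one : OscBound (fun _ => 1) 6 where
  cont := continuousOn_const
  int := intervalIntegrable_const
  bound t ht ρ a _ := by simpa using norm_integral_quadratic_phase_le t ht ρ 0 a

lemma OscBound.congr {h h' : ℝ → ℂ} {M : ℝ} (hh : OscBound h M)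
    (e : ∀ u ∈ Set.Ioo (0 : ℝ) 2, h' u = h u) : OscBound h' M where
  cont := hh.cont.congr e
  int := by
    have := hh.int
    rw [intervalIntegrable_iff_integrableOn_Ioo_of_le (by norm_num)] at this ⊢
    exact this.congr_fun (fun u hu => (e u hu).symm) measurableSet_Ioo
  bound t ht ρ a ha := by
    refine le_trans (le_of_eq ?_) (hh.bound t ht ρ a ha)
    congr 1
    rw [intervalIntegral.integral_of_le ha.1, intervalIntegral.integral_of_le ha.1,
      integral_Ioc_eq_integral_Ioo, integral_Ioc_eq_integral_Ioo]
    refine setIntegral_congr_fun measurableSet_Ioo fun u hu => ?_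
    rw [e u ⟨hu.1, hu.2.trans_le ha.2⟩]

lemma OscBound.mono {h : ℝ → ℂ} {M M' : ℝ} (hh : OscBound h M) (hM : M ≤ M') :
    OscBound h M' where
  cont := hh.cont
  int := hh.int
  bound t ht ρ a ha := (hh.bound t ht ρ a ha).trans (by gcongr)

lemma OscBound.int_phase {h : ℝ → ℂ} {M : ℝ} (hh : OscBound h M) (t ρ : ℝ) {a b : ℝ}
    (ha : a ∈ Set.Icc (0 : ℝ) 2) (hb : b ∈ Set.Icc (0 : ℝ) 2) : IntervalIntegrable
      (fun u => Complex.exp (I * ((t * u ^ 2 + ρ * u : ℝ) : ℂ)) * h u) volume a b := by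
  refine IntervalIntegrable.continuousOn_mul (hh.int.mono_set ?_) (by fun_prop)
  rw [Set.uIcc_of_le (zero_le_two)]
  exact Set.uIcc_subset_Icc ha hb

lemma OscMul.congr {f f' : ℝ → ℂ} {B : ℝ} (hf : OscMul f B)
    (e : ∀ u ∈ Set.Ioo (0 : ℝ) 2, f' u = f u) : OscMul f' B := fun h M hh =>
  (hf h M hh).congr fun u hu => by rw [e u hu]

lemma OscMul.mono {f : ℝ → ℂ} {B B' : ℝ} (hf : OscMul f B) (hB : B ≤ B') : OscMul f B' :=
  fun h M hh => (hf h M hh).mono (mul_le_mul_of_nonneg_right hB hh.nonneg)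

lemma OscMul.nonneg {f : ℝ → ℂ} {B : ℝ} (hf : OscMul f B) : 0 ≤ B := by
  have := (hf _ _ OscBound.one).nonneg
  linarith

lemma OscMul.mul {f g : ℝ → ℂ} {A B : ℝ} (hf : OscMul f A) (hg : OscMul g B) :
    OscMul (fun u => f u * g u) (A * B) := fun h M hh => by
  simpa only [mul_assoc] using hf _ _ (hg h M hh)

lemma OscMul.add {f g : ℝ → ℂ} {A B : ℝ} (hf : OscMul f A) (hg : OscMul g B) :
    OscMul (fun u => f u + g u) (A + B) := fun h M hh => by
  have h1 := hf h M hh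
  have h2 := hg h M hh
  have e : (fun u => (f u + g u) * h u) = fun u => f u * h u + g u * h u := by
    ext u; ring
  rw [e]
  refine ⟨h1.cont.add h2.cont, h1.int.add h2.int, fun t ht ρ a ha => ?_⟩
  have h0 : (0 : ℝ) ∈ Set.Icc (0 : ℝ) 2 := by simp
  simp_rw [mul_add]
  rw [intervalIntegral.integral_add (h1.int_phase t ρ h0 ha) (h2.int_phase t ρ h0 ha), add_mul,
    add_div]
  exact (norm_add_le _ _).trans (add_le_add (h1.bound t ht ρ a ha) (h2.bound t ht ρ a ha))

lemma OscMul.const (c : ℂ) : OscMul (fun _ => c) ‖c‖ := fun h M hh => by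
  refine ⟨continuousOn_const.mul hh.cont, hh.int.const_mul c, fun t ht ρ a ha => ?_⟩
  have e : (fun u : ℝ => Complex.exp (I * ((t * u ^ 2 + ρ * u : ℝ) : ℂ)) * (c * h u)) =
      fun u : ℝ => c * (Complex.exp (I * ((t * u ^ 2 + ρ * u : ℝ) : ℂ)) * h u) := by
    ext u; ring
  rw [e, intervalIntegral.integral_const_mul, norm_mul, mul_div_assoc]
  exact mul_le_mul_of_nonneg_left (hh.bound t ht ρ a ha) (norm_nonneg _)

lemma OscMul.const_mul {f : ℝ → ℂ} {A : ℝ} (hf : OscMul f A) (c : ℂ) :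
    OscMul (fun u => c * f u) (‖c‖ * A) := (OscMul.const c).mul hf

lemma OscMul.sum {ι : Type*} (s : Finset ι) {f : ι → ℝ → ℂ} {A : ι → ℝ}
    (hf : ∀ i ∈ s, OscMul (f i) (A i)) :
    OscMul (fun u => ∑ i ∈ s, f i u) (∑ i ∈ s, A i) := by
  classical
  induction s using Finset.induction_on with
  | empty => simpa using OscMul.const 0
  | insert i s hi ih =>
    simp_rw [Finset.sum_insert hi]
    exact (hf i (by simp)).add (ih fun j hj => hf j (by simp [hj]))

lemma OscMul.exp (r : ℝ) : OscMul (fun u => Complex.exp (I * ((r * u : ℝ) : ℂ))) 1 :=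
    fun h M hh => by
  refine ⟨ContinuousOn.mul (by fun_prop) hh.cont, hh.int.continuousOn_mul (by fun_prop),
    fun t ht ρ a ha => ?_⟩
  have e : (fun u : ℝ => Complex.exp (I * ((t * u ^ 2 + ρ * u : ℝ) : ℂ)) *
      (Complex.exp (I * ((r * u : ℝ) : ℂ)) * h u)) =
      fun u : ℝ => Complex.exp (I * ((t * u ^ 2 + (ρ + r) * u : ℝ) : ℂ)) * h u := by
    ext u
    rw [← mul_assoc, ← Complex.exp_add]
    congr 2
    push_cast
    ring
  rw [e, one_mul]
  exact hh.bound t ht (ρ + r) a ha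

/-- A function with bounded derivative is a multiplier, by integration by parts. -/
lemma OscMul.of_deriv {b b' : ℝ → ℂ} {B B' : ℝ} (hc : ContinuousOn b (Set.Icc 0 2))
    (hc' : ContinuousOn b' (Set.Ioo 0 2))
    (hd : ∀ u ∈ Set.Ioo (0 : ℝ) 2, HasDerivAt b (b' u) u)
    (hB : ∀ u ∈ Set.Icc (0 : ℝ) 2, ‖b u‖ ≤ B) (hB' : ∀ u ∈ Set.Ioo (0 : ℝ) 2, ‖b' u‖ ≤ B') :
    OscMul b (B + 2 * B') := fun h M hh => by
  have h02 : (0 : ℝ) ≤ 2 := zero_le_two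
  have hB'0 : 0 ≤ B' := (norm_nonneg _).trans (hB' 1 ⟨one_pos, one_lt_two⟩)
  refine ⟨(hc.mono Set.Ioo_subset_Icc_self).mul hh.cont,
    hh.int.continuousOn_mul (by rwa [Set.uIcc_of_le h02]), fun t ht ρ a ha => ?_⟩
  have hz : (0 : ℝ) ∈ Set.Icc (0 : ℝ) 2 := by simp
  set φ : ℝ → ℂ := fun u => Complex.exp (I * ((t * u ^ 2 + ρ * u : ℝ) : ℂ)) * h u with hφ
  have hφi : IntervalIntegrable φ volume 0 a := hh.int_phase t ρ hz ha
  have hφc : ContinuousOn φ (Set.Ioo 0 2) := ContinuousOn.mul (by fun_prop) hh.cont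
  set G : ℝ → ℂ := fun v => ∫ u in (0 : ℝ)..v, φ u with hG
  have hGd : ∀ v ∈ Set.Ioo 0 a, HasDerivAt G (φ v) v := by
    intro v hv
    have hv2 : v ∈ Set.Ioo (0 : ℝ) 2 := ⟨hv.1, hv.2.trans_le ha.2⟩
    refine intervalIntegral.integral_hasDerivAt_right
      (hh.int_phase t ρ hz ⟨hv2.1.le, hv2.2.le⟩) ?_ (hφc.continuousAt (Ioo_mem_nhds hv2.1 hv2.2))
    exact hφc.stronglyMeasurableAtFilter isOpen_Ioo v hv2
  have hGc : ContinuousOn G (Set.uIcc 0 a) :=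
    intervalIntegral.continuousOn_primitive_interval' hφi (by simp)
  have hGb : ∀ v ∈ Set.Icc (0 : ℝ) 2, ‖G v‖ ≤ M / √|t| := fun v hv => hh.bound t ht ρ v hv
  have hb'i : IntervalIntegrable b' volume 0 a := by
    rw [intervalIntegrable_iff_integrableOn_Ioo_of_le ha.1]
    refine ⟨(hc'.mono (Set.Ioo_subset_Ioo_right ha.2)).aestronglyMeasurable measurableSet_Ioo,
      HasFiniteIntegral.restrict_of_bounded (C := B') (by simp) ?_⟩
    filter_upwards [ae_restrict_mem measurableSet_Ioo] with u hu
    exact hB' u ⟨hu.1, hu.2.trans_le ha.2⟩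
  have key := intervalIntegral.integral_mul_deriv_eq_deriv_mul_of_hasDerivAt
    (u := b) (v := G) (u' := b') (v' := φ) (a := 0) (b := a)
    (by rw [Set.uIcc_of_le ha.1]; exact hc.mono (Set.Icc_subset_Icc_right ha.2)) hGc
    (by
      rw [min_eq_left ha.1, max_eq_right ha.1]
      exact fun u hu => hd u ⟨hu.1, hu.2.trans_le ha.2⟩)
    (by rw [min_eq_left ha.1, max_eq_right ha.1]; exact hGd) hb'i hφi
  have e : ∫ u in (0 : ℝ)..a, Complex.exp (I * ((t * u ^ 2 + ρ * u : ℝ) : ℂ)) * (b u * h u) =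
      ∫ u in (0 : ℝ)..a, b u * φ u := by
    refine intervalIntegral.integral_congr fun u _ => ?_
    simp only [hφ]
    ring
  have hG0 : G 0 = 0 := by simp [hG]
  have hM : 0 ≤ M / √|t| := div_nonneg hh.nonneg (Real.sqrt_nonneg _)
  have hi : ‖∫ u in (0 : ℝ)..a, b' u * G u‖ ≤ 2 * B' * (M / √|t|) := by
    rw [intervalIntegral.integral_of_le ha.1, integral_Ioc_eq_integral_Ioo]
    refine (norm_setIntegral_le_of_norm_le_const (C := B' * (M / √|t|)) (by simp) ?_).trans ?_
    · intro u hu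
      have hu2 : u ∈ Set.Ioo (0 : ℝ) 2 := ⟨hu.1, hu.2.trans_le ha.2⟩
      rw [norm_mul]
      exact mul_le_mul (hB' u hu2) (hGb u ⟨hu2.1.le, hu2.2.le⟩) (norm_nonneg _) hB'0
    · simp only [Measure.real, Real.volume_Ioo, sub_zero, ENNReal.toReal_ofReal ha.1]
      have := mul_nonneg hB'0 hM
      nlinarith [ha.2]
  rw [e, key, hG0, mul_zero, sub_zero]
  refine (norm_sub_le _ _).trans ?_
  have h1 : ‖b a * G a‖ ≤ B * (M / √|t|) := by
    rw [norm_mul]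
    exact mul_le_mul (hB a ha) (hGb a ha) (norm_nonneg _) ((norm_nonneg _).trans (hB a ha))
  calc _ ≤ B * (M / √|t|) + 2 * B' * (M / √|t|) := add_le_add h1 hi
    _ = _ := by ring

lemma OscMul.of_contDiff {b : ℝ → ℂ} (hb : ContDiff ℝ 1 b) : ∃ B, OscMul b B := by
  have hc : ContinuousOn b (Set.Icc 0 2) := hb.continuous.continuousOn
  have hc' : ContinuousOn (deriv b) (Set.Icc 0 2) := (hb.continuous_deriv le_rfl).continuousOn
  obtain ⟨B, hB⟩ := isCompact_Icc.exists_bound_of_continuousOn hc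
  obtain ⟨B', hB'⟩ := isCompact_Icc.exists_bound_of_continuousOn hc'
  exact ⟨_, OscMul.of_deriv hc (hc'.mono Set.Ioo_subset_Icc_self)
    (fun u _ => (hb.differentiable one_ne_zero u).hasDerivAt) hB
    fun u hu => hB' u (Set.Ioo_subset_Icc_self hu)⟩

/-- A sequence of functions, each being the derivative of its predecessor with respect to `λ²`,
together with multiplier bounds growing geometrically in the order and with limits at `0`. -/
structure OscChain (m : ℕ) (ρ A : ℝ) (c : ℕ → ℂ) (u : ℕ → ℝ → ℂ) : Prop where
  deriv : ∀ s < m, ∀ x ∈ Set.Ioo (0 : ℝ) 2, HasDerivAt (u s) (2 * x * u (s + 1) x) x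
  mul : ∀ s < m, OscMul (u s) (A * ρ ^ s)
  top : OscMul (fun x => x * u m x) (A * ρ ^ m)
  lim : ∀ s < m, Filter.Tendsto (u s) (nhdsWithin 0 (Set.Ioi 0)) (nhds (c s))

/-- The Leibniz convolution of two sequences. -/
def leibniz {R : Type*} [CommSemiring R] (u v : ℕ → R) (s : ℕ) : R :=
  ∑ ij ∈ antidiagonal s, (s.choose ij.1 : R) * (u ij.1 * v ij.2)

lemma OscMul.id : OscMul (fun x => (x : ℂ)) 4 := by
  have := OscMul.of_deriv (b := fun x : ℝ => (x : ℂ)) (b' := fun _ => 1) (B := 2) (B' := 1)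
    (by fun_prop) continuousOn_const (fun u _ => Complex.ofRealCLM.hasDerivAt)
    (fun u hu => by simpa [abs_of_nonneg hu.1] using hu.2) (by simp)
  exact this.mono (by norm_num)

lemma sum_antidiagonal_choose_eq (s : ℕ) :
    ∑ ij ∈ antidiagonal s, s.choose ij.1 = 2 ^ s := by
  rw [Finset.Nat.sum_antidiagonal_eq_sum_range_succ_mk, Nat.sum_range_choose]

lemma OscChain.leibniz {m : ℕ} (hm : 0 < m) {ρ A B : ℝ} {c d : ℕ → ℂ} {u v : ℕ → ℝ → ℂ}
    (hu : OscChain m ρ A c u) (hv : OscChain m ρ B d v) :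
    OscChain m ρ (4 * 2 ^ m * (A * B)) (leibniz c d)
      (fun s x => _root_.leibniz (fun i => u i x) (fun j => v j x) s) where
  deriv s hs x hx := by
    have h1 : ∀ ij ∈ antidiagonal s, HasDerivAt
        (fun x => (s.choose ij.1 : ℂ) * (u ij.1 x * v ij.2 x))
        ((s.choose ij.1 : ℂ) * (2 * x * u (ij.1 + 1) x * v ij.2 x +
          u ij.1 x * (2 * x * v (ij.2 + 1) x))) x := by
      intro ij hij
      have := mem_antidiagonal.1 hij
      exact ((hu.deriv ij.1 (by omega) x hx).mul (hv.deriv ij.2 (by omega) x hx)).const_mul _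
    have h2 := HasDerivAt.fun_sum h1
    unfold _root_.leibniz
    refine h2.congr_deriv ?_
    symm
    rw [sum_antidiagonal_choose_succ_mul (fun i j => u i x * v j x), mul_add, mul_sum, mul_sum,
      ← sum_add_distrib]
    refine sum_congr rfl fun ij hij => ?_
    have : s.choose ij.2 = s.choose ij.1 := by
      rw [← mem_antidiagonal.1 hij, Nat.choose_symm_add]
    rw [this]
    ring
  mul s hs := by
    have hA := (hu.mul 0 hm).nonneg
    have hB := (hv.mul 0 hm).nonneg
    simp only [pow_zero, mul_one] at hA hB
    have hρ : 0 ≤ A * B * ρ ^ s := by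
      have := mul_nonneg (hu.mul s hs).nonneg hB
      linarith
    unfold _root_.leibniz
    have h1 : ∀ ij ∈ antidiagonal s, OscMul (fun x => (s.choose ij.1 : ℂ) * (u ij.1 x * v ij.2 x))
        ((s.choose ij.1 : ℝ) * (A * B * ρ ^ s)) := by
      intro ij hij
      have hs' := mem_antidiagonal.1 hij
      convert (((hu.mul ij.1 (by omega)).mul (hv.mul ij.2 (by omega))).const_mul _) using 1
      rw [Complex.norm_natCast, ← hs', pow_add]
      ring
    refine (OscMul.sum _ h1).mono ?_
    rw [← sum_mul, ← Nat.cast_sum, sum_antidiagonal_choose_eq]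
    have : (2 : ℝ) ^ s ≤ 2 ^ m := pow_le_pow_right₀ one_le_two hs.le
    push_cast
    nlinarith [mul_le_mul_of_nonneg_right this hρ,
      mul_nonneg (pow_nonneg (zero_le_two (α := ℝ)) m) hρ]
  top := by
    have hA := (hu.mul 0 hm).nonneg
    have hB := (hv.mul 0 hm).nonneg
    simp only [pow_zero, mul_one] at hA hB
    have hρ : 0 ≤ A * B * ρ ^ m := by
      have := mul_nonneg hu.top.nonneg hB
      linarith
    unfold _root_.leibniz
    have h1 : ∀ ij ∈ antidiagonal m, OscMul
        (fun x => (m.choose ij.1 : ℂ) * (x * (u ij.1 x * v ij.2 x)))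
        ((m.choose ij.1 : ℝ) * (4 * (A * B * ρ ^ m))) := by
      intro ij hij
      have hs' := mem_antidiagonal.1 hij
      have h2 : OscMul (fun x => x * (u ij.1 x * v ij.2 x)) (4 * (A * B * ρ ^ m)) := by
        rcases Nat.eq_zero_or_pos ij.1 with h0 | h0
        · have e : ij.2 = m := by omega
          rw [h0, e]
          refine (((hu.mul 0 hm).mul hv.top).congr fun x _ => by ring).mono ?_
          nlinarith
        · rcases Nat.eq_zero_or_pos ij.2 with h0' | h0'
          · have e : ij.1 = m := by omega
            rw [h0', e]
            refine ((hu.top.mul (hv.mul 0 hm)).congr fun x _ => by ring).mono ?_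
            nlinarith
          · refine (OscMul.id.mul ((hu.mul ij.1 (by omega)).mul (hv.mul ij.2 (by omega)))).mono ?_
            rw [← hs', pow_add]
            apply le_of_eq
            ring
      convert h2.const_mul _ using 1
      simp
    refine ((OscMul.sum _ h1).congr fun x _ => ?_).mono ?_
    · rw [mul_sum]
      exact sum_congr rfl fun ij _ => by ring
    · rw [← sum_mul, ← Nat.cast_sum, sum_antidiagonal_choose_eq]
      apply le_of_eq
      push_cast
      ring
  lim s hs := by
    unfold _root_.leibniz
    refine tendsto_finsetSum _ fun ij hij => ?_
    have hs' := mem_antidiagonal.1 hij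
    exact ((hu.lim ij.1 (by omega)).mul (hv.lim ij.2 (by omega))).const_mul _

lemma OscChain.add {m : ℕ} {ρ A B : ℝ} {c d : ℕ → ℂ} {u v : ℕ → ℝ → ℂ}
    (hu : OscChain m ρ A c u) (hv : OscChain m ρ B d v) :
    OscChain m ρ (A + B) (fun s => c s + d s) (fun s x => u s x + v s x) where
  deriv s hs x hx := by
    refine ((hu.deriv s hs x hx).add (hv.deriv s hs x hx)).congr_deriv ?_
    ring
  mul s hs := by
    rw [add_mul]
    exact (hu.mul s hs).add (hv.mul s hs)
  top := by
    rw [add_mul]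
    exact (hu.top.add hv.top).congr fun x _ => by ring
  lim s hs := (hu.lim s hs).add (hv.lim s hs)

lemma OscChain.neg {m : ℕ} {ρ A : ℝ} {c : ℕ → ℂ} {u : ℕ → ℝ → ℂ}
    (hu : OscChain m ρ A c u) :
    OscChain m ρ A (fun s => - c s) (fun s x => - u s x) where
  deriv s hs x hx := by
    refine (hu.deriv s hs x hx).neg.congr_deriv ?_
    ring
  mul s hs := by
    have := (hu.mul s hs).const_mul (-1)
    simpa using this
  top := by
    have := hu.top.const_mul (-1)
    simpa using this
  lim s hs := (hu.lim s hs).neg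

lemma OscChain.mono {m : ℕ} {ρ A B : ℝ} (hρ : 0 ≤ ρ) {c : ℕ → ℂ} {u : ℕ → ℝ → ℂ}
    (hu : OscChain m ρ A c u) (h : A ≤ B) : OscChain m ρ B c u where
  deriv := hu.deriv
  mul s hs := (hu.mul s hs).mono (by gcongr)
  top := hu.top.mono (by gcongr)
  lim := hu.lim

/-- Repeated integration by parts in the variable `λ²` for a chain vanishing at both ends. -/
lemma OscChain.norm_integral_le {m : ℕ} {ρ A : ℝ} {u : ℕ → ℝ → ℂ}
    (hu : OscChain m ρ A 0 u) (hm : 0 < m)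
    (hend : ∀ s < m, ∀ᶠ x in nhdsWithin (2 : ℝ) (Set.Iio 2), u s x = 0) (t : ℝ) (ht : t ≠ 0) :
    ‖∫ x in (0 : ℝ)..2, Complex.exp (I * t * (x : ℂ) ^ 2) * (x * u 0 x)‖ ≤
      6 * (A * ρ ^ m) * |t| ^ (-(2 * (m : ℝ) + 1) / 2) := by
  have h_int : ∀ s ≤ m, IntervalIntegrable (fun x => x * u s x) volume 0 2 := by
    intro s hs
    rcases hs.lt_or_eq with hs | rfl
    · simpa using ((OscMul.id.mul (hu.mul s hs)) _ _ OscBound.one).int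
    · simpa using (hu.top _ _ OscBound.one).int
  have h_int' : ∀ s ≤ m, IntervalIntegrable
      (fun x => Complex.exp (I * t * (x : ℂ) ^ 2) * (x * u s x)) volume 0 2 := fun s hs =>
    (h_int s hs).continuousOn_mul (by fun_prop)
  have step : ∀ s < m, ‖∫ x in (0 : ℝ)..2, Complex.exp (I * t * (x : ℂ) ^ 2) * (x * u s x)‖ =
      |t|⁻¹ * ‖∫ x in (0 : ℝ)..2, Complex.exp (I * t * (x : ℂ) ^ 2) * (x * u (s + 1) x)‖ := by
    intro s hs
    have hd : ∀ x ∈ Set.Ioo (0 : ℝ) 2, HasDerivAt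
        (fun x : ℝ => Complex.exp (I * t * (x : ℂ) ^ 2) * u s x)
        (2 * I * t * (Complex.exp (I * t * (x : ℂ) ^ 2) * (x * u s x)) +
          2 * (Complex.exp (I * t * (x : ℂ) ^ 2) * (x * u (s + 1) x))) x := by
      intro x hx
      have h1 : HasDerivAt (fun x : ℝ => I * t * (x : ℂ) ^ 2) (I * t * (2 * x)) x := by
        simpa using ((Complex.ofRealCLM.hasDerivAt (x := x)).pow 2).const_mul (I * t)
      refine (h1.cexp.mul (hu.deriv s hs x hx)).congr_deriv ?_
      ring
    have hT0 : Filter.Tendsto (fun x : ℝ => Complex.exp (I * t * (x : ℂ) ^ 2) * u s x)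
        (nhdsWithin 0 (Set.Ioi 0)) (nhds 0) := by
      have h1 : Filter.Tendsto (fun x : ℝ => Complex.exp (I * t * (x : ℂ) ^ 2))
          (nhdsWithin 0 (Set.Ioi 0)) (nhds (Complex.exp (I * t * ((0 : ℝ) : ℂ) ^ 2))) :=
        (Continuous.tendsto (by fun_prop) 0).mono_left nhdsWithin_le_nhds
      simpa using h1.mul (hu.lim s hs)
    have hT2 : Filter.Tendsto (fun x : ℝ => Complex.exp (I * t * (x : ℂ) ^ 2) * u s x)
        (nhdsWithin 2 (Set.Iio 2)) (nhds 0) := by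
      refine tendsto_const_nhds.congr' ?_
      filter_upwards [hend s hs] with x hx
      simp [hx]
    have key := intervalIntegral.integral_eq_sub_of_hasDerivAt_of_tendsto zero_lt_two hd
      (((h_int' s hs.le).const_mul _).add ((h_int' (s + 1) hs).const_mul _)) hT0 hT2
    rw [intervalIntegral.integral_add ((h_int' s hs.le).const_mul _)
      ((h_int' (s + 1) hs).const_mul _), intervalIntegral.integral_const_mul,
      intervalIntegral.integral_const_mul, sub_zero] at key
    have := congrArg norm (eq_neg_of_add_eq_zero_left key)
    simp only [norm_neg, norm_mul, Complex.norm_I, Complex.norm_real, Real.norm_eq_abs,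
      Complex.norm_ofNat, mul_one] at this
    have htp : 0 < |t| := abs_pos.2 ht
    rw [eq_inv_mul_iff_mul_eq₀ htp.ne']
    linarith
  have iter : ∀ s ≤ m, ‖∫ x in (0 : ℝ)..2, Complex.exp (I * t * (x : ℂ) ^ 2) * (x * u 0 x)‖ =
      |t|⁻¹ ^ s * ‖∫ x in (0 : ℝ)..2, Complex.exp (I * t * (x : ℂ) ^ 2) * (x * u s x)‖ := by
    intro s
    induction s with
    | zero => simp
    | succ s ih =>
      intro hs
      rw [ih (by omega), step s (by omega), pow_succ, mul_assoc]
  rw [iter m le_rfl]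
  have htop := (hu.top _ _ OscBound.one).bound t ht 0 2 (by simp)
  have e : ∀ x : ℝ, I * ((t * x ^ 2 + 0 * x : ℝ) : ℂ) = I * t * (x : ℂ) ^ 2 := by
    intro x; push_cast; ring
  simp only [e, mul_one] at htop
  have htp : 0 < |t| := abs_pos.2 ht
  have e2 : |t| ^ (-(2 * (m : ℝ) + 1) / 2) = |t|⁻¹ ^ m * (√|t|)⁻¹ := by
    rw [Real.sqrt_eq_rpow, ← Real.rpow_neg htp.le, inv_pow, ← Real.rpow_natCast,
      ← Real.rpow_neg htp.le,
      ← Real.rpow_add htp]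
    congr 1
    ring
  rw [e2]
  calc _ ≤ |t|⁻¹ ^ m * (A * ρ ^ m * 6 / √|t|) := by gcongr
    _ = _ := by ring

/-- Coefficients of the reverse Bessel polynomials. -/
noncomputable def besselCoeff (q l : ℕ) : ℂ :=
  (Nat.factorial (2 * q - l) : ℂ) / ((Nat.factorial l : ℂ) * (Nat.factorial (q - l) : ℂ))

lemma besselCoeff_self (q : ℕ) : besselCoeff q q = 1 := by
  have h : 2 * q - q = q := by omega
  have h1 : (Nat.factorial q : ℂ) ≠ 0 := by exact_mod_cast Nat.factorial_ne_zero q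
  rw [besselCoeff, h, Nat.sub_self, Nat.factorial_zero, Nat.cast_one, mul_one, div_self h1]

lemma besselCoeff_succ_one (q : ℕ) : 2 * besselCoeff (q + 1) 1 = besselCoeff (q + 1) 0 := by
  have h : 2 * (q + 1) - 1 = 2 * q + 1 := by omega
  have h' : 2 * (q + 1) - 0 = 2 * q + 1 + 1 := by omega
  simp only [besselCoeff, h, h', Nat.factorial_succ, Nat.factorial_zero,
    Nat.add_sub_cancel, Nat.sub_zero]
  have : (Nat.factorial q : ℂ) ≠ 0 := by exact_mod_cast Nat.factorial_ne_zero q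
  have h2 : ((q : ℂ) + 1) ≠ 0 := by exact_mod_cast Nat.succ_ne_zero q
  push_cast
  field_simp
  ring_nf

lemma besselCoeff_rec (l j : ℕ) :
    2 * ((l : ℂ) + 2) * besselCoeff (l + j + 2) (l + 2) =
      besselCoeff (l + j + 2) (l + 1) - besselCoeff (l + j + 1) l := by
  have h1 : 2 * (l + j + 2) - (l + 2) = l + 2 * j + 2 := by omega
  have h2 : 2 * (l + j + 2) - (l + 1) = l + 2 * j + 2 + 1 := by omega
  have h3 : 2 * (l + j + 1) - l = l + 2 * j + 2 := by omega
  have h4 : l + j + 2 - (l + 2) = j := by omega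
  have h5 : l + j + 2 - (l + 1) = j + 1 := by omega
  have h6 : l + j + 1 - l = j + 1 := by omega
  simp only [besselCoeff, h1, h2, h3, h4, h5, h6, Nat.factorial_succ]
  have a1 : (Nat.factorial l : ℂ) ≠ 0 := by exact_mod_cast Nat.factorial_ne_zero l
  have a2 : (Nat.factorial j : ℂ) ≠ 0 := by exact_mod_cast Nat.factorial_ne_zero j
  have b1 : ((l : ℂ) + 1) ≠ 0 := by exact_mod_cast Nat.succ_ne_zero l
  have b2 : ((j : ℂ) + 1) ≠ 0 := by exact_mod_cast Nat.succ_ne_zero j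
  have b3 : ((l : ℂ) + 1 + 1) ≠ 0 := by exact_mod_cast Nat.succ_ne_zero (l + 1)
  push_cast
  field_simp
  ring

/-- The recurrence expressing that `exp (-x)` times the reverse Bessel polynomial of degree `q + 1`
has derivative `-2 x exp (-x)` times the one of degree `q`. -/
lemma sum_besselCoeff_deriv (q : ℕ) (y : ℂ) :
    ∑ l ∈ range (q + 1), 2 * ((l : ℂ) + 1) * besselCoeff (q + 1) (l + 1) * y ^ l =
      (∑ l ∈ range (q + 2), besselCoeff (q + 1) l * y ^ l) -
        y * ∑ l ∈ range (q + 1), besselCoeff q l * y ^ l := by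
  rw [sum_range_succ' (fun l => besselCoeff (q + 1) l * y ^ l), mul_sum, add_sub_right_comm,
    ← sum_sub_distrib, sum_range_succ' (fun l : ℕ => 2 * ((l : ℂ) + 1) *
      besselCoeff (q + 1) (l + 1) * y ^ l), sum_range_succ, besselCoeff_self, besselCoeff_self]
  have h : ∀ l ∈ range q, besselCoeff (q + 1) (l + 1) * y ^ (l + 1) -
      y * (besselCoeff q l * y ^ l) =
      2 * (((l + 1 : ℕ) : ℂ) + 1) * besselCoeff (q + 1) (l + 1 + 1) * y ^ (l + 1) := by
    intro l hl
    obtain ⟨j, rfl⟩ : ∃ j, q = l + j + 1 := ⟨q - l - 1, by have := mem_range.1 hl; omega⟩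
    have := besselCoeff_rec l j
    have e : l + j + 1 + 1 = l + j + 2 := rfl
    have e' : l + 1 + 1 = l + 2 := rfl
    rw [e, e']
    push_cast
    linear_combination (-y ^ (l + 1)) * this
  rw [sum_congr rfl h, ← besselCoeff_succ_one]
  push_cast
  ring

/-- The free resolvent kernel in dimension `2 q + 3`, without its constant. -/
noncomputable def greenKer (q : ℕ) (r x : ℝ) : ℂ :=
  Complex.exp (I * x * r) / (r : ℂ) ^ (2 * q + 1) *
    ∑ l ∈ range (q + 1), besselCoeff q l * ((-2) * I * r * x) ^ l

lemma gker_eq (p : ℕ) (x r : ℝ) : gker (2 * p + 3) x r = resC (2 * p + 3) * greenKer p r x := by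
  have h1 : 2 * p + 3 - 3 = 2 * p := by omega
  have h2 : 2 * p + 3 - 2 = 2 * p + 1 := by omega
  have h3 : 2 * p / 2 = p := by omega
  simp only [gker, greenKer, besselCoeff, h1, h2, h3]
  ring

lemma continuous_greenKer (q : ℕ) (r : ℝ) : Continuous (greenKer q r) := by
  unfold greenKer
  fun_prop

lemma hasDerivAt_greenKer_zero {r : ℝ} (hr : r ≠ 0) (x : ℝ) :
    HasDerivAt (greenKer 0 r) (I * Complex.exp (I * x * r)) x := by
  have h1 : HasDerivAt (fun x : ℝ => I * (x : ℂ) * r) (I * r) x := by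
    simpa using ((Complex.ofRealCLM.hasDerivAt (x := x)).const_mul I).mul_const (r : ℂ)
  have e : greenKer 0 r = fun x : ℝ => Complex.exp (I * x * r) / r := by
    ext x; simp [greenKer, besselCoeff]
  rw [e]
  refine (h1.cexp.div_const (r : ℂ)).congr_deriv ?_
  have : (r : ℂ) ≠ 0 := by exact_mod_cast hr
  field_simp

lemma hasDerivAt_greenKer_succ (q : ℕ) {r : ℝ} (hr : r ≠ 0) (x : ℝ) :
    HasDerivAt (greenKer (q + 1) r) (2 * x * greenKer q r x) x := by
  have hr' : (r : ℂ) ≠ 0 := by exact_mod_cast hr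
  have h1 : HasDerivAt (fun x : ℝ => I * (x : ℂ) * r) (I * r) x := by
    simpa using ((Complex.ofRealCLM.hasDerivAt (x := x)).const_mul I).mul_const (r : ℂ)
  have h2 : HasDerivAt (fun x : ℝ => (-2) * I * (r : ℂ) * x) ((-2) * I * r) x := by
    simpa using (Complex.ofRealCLM.hasDerivAt (x := x)).const_mul ((-2) * I * (r : ℂ))
  have h3 : HasDerivAt (fun x : ℝ => ∑ l ∈ range (q + 1 + 1),
      besselCoeff (q + 1) l * ((-2) * I * r * x) ^ l)
      (∑ l ∈ range (q + 1 + 1), besselCoeff (q + 1) l *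
        (l * ((-2) * I * r * x) ^ (l - 1) * ((-2) * I * r))) x :=
    HasDerivAt.fun_sum fun l _ => (h2.pow l).const_mul _
  refine ((h1.cexp.div_const ((r : ℂ) ^ (2 * (q + 1) + 1))).mul h3).congr_deriv ?_
  have h4 := sum_besselCoeff_deriv q ((-2) * I * r * x)
  have h5 : ∑ l ∈ range (q + 1 + 1), besselCoeff (q + 1) l *
        (l * ((-2) * I * r * x) ^ (l - 1) * ((-2) * I * r)) =
      - (I * r) * ∑ l ∈ range (q + 1), 2 * ((l : ℂ) + 1) * besselCoeff (q + 1) (l + 1) *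
        ((-2) * I * r * x) ^ l := by
    rw [sum_range_succ', mul_sum]
    simp only [Nat.cast_zero, zero_mul, mul_zero, add_zero, Nat.add_sub_cancel]
    refine sum_congr rfl fun l _ => ?_
    push_cast
    ring
  rw [h5, h4]
  unfold greenKer
  have hI : I ^ 2 = -1 := I_sq
  have e1 : (r : ℂ) ^ (2 * (q + 1) + 1) = r ^ (2 * q + 1) * r ^ 2 := by ring
  rw [e1]
  field_simp
  ring_nf
  simp only [hI]
  ring_nf

/-- The successive derivatives of `x ↦ greenKer p r (σ x)` with respect to `x ^ 2`. -/
noncomputable def greenSeq (p : ℕ) (σ r : ℝ) (s : ℕ) (x : ℝ) : ℂ :=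
  if s ≤ p then greenKer (p - s) r (σ * x)
  else I * σ * Complex.exp (I * ((σ * r * x : ℝ) : ℂ)) / (2 * x)

/-- The size of the free resolvent kernel in dimension `2 p + 3` at frequencies `|λ| ≤ 1`. -/
noncomputable def omg (p : ℕ) (r : ℝ) : ℝ := (1 + r) ^ p / r ^ (2 * p + 1)

lemma omg_nonneg (p : ℕ) {r : ℝ} (hr : 0 ≤ r) : 0 ≤ omg p r := by unfold omg; positivity

lemma OscMul.pow (l : ℕ) : OscMul (fun x => (x : ℂ) ^ l) (4 ^ l) := by
  induction l with
  | zero => simpa using OscMul.const 1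
  | succ l ih => simpa only [pow_succ] using ih.mul OscMul.id

/-- A constant controlling `greenKer q`. -/
noncomputable def greenConst (q : ℕ) : ℝ := ∑ l ∈ range (q + 1), ‖besselCoeff q l‖ * 8 ^ l

lemma greenConst_nonneg (q : ℕ) : 0 ≤ greenConst q :=
  sum_nonneg fun _ _ => by positivity

lemma OscMul.greenKer (q : ℕ) {σ : ℝ} (hσ : |σ| = 1) {r : ℝ} (hr : 0 < r) :
    OscMul (fun x => greenKer q r (σ * x)) (greenConst q * omg q r) := by
  have h1 : ∀ l ∈ range (q + 1), OscMul
      (fun x => (besselCoeff q l * ((-2) * I * r * σ) ^ l / (r : ℂ) ^ (2 * q + 1)) *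
        ((x : ℂ) ^ l * Complex.exp (I * ((σ * r * x : ℝ) : ℂ))))
      (‖besselCoeff q l‖ * 8 ^ l * omg q r) := by
    intro l hl
    refine (((OscMul.pow l).mul (OscMul.exp (σ * r))).const_mul _).mono ?_
    simp only [norm_div, norm_mul, norm_pow, norm_neg, Complex.norm_ofNat, Complex.norm_I,
      Complex.norm_real, Real.norm_eq_abs, hσ, abs_of_pos hr, mul_one]
    have h2 : r ^ l ≤ (1 + r) ^ q :=
      (pow_le_pow_left₀ hr.le (by linarith) l).trans
        (pow_le_pow_right₀ (by linarith) (by have := mem_range.1 hl; omega))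
    have e : (2 * r) ^ l * 4 ^ l = 8 ^ l * r ^ l := by
      rw [mul_pow, mul_right_comm, ← mul_pow]; norm_num
    unfold omg
    calc _ = ‖besselCoeff q l‖ * (((2 * r) ^ l * 4 ^ l) / r ^ (2 * q + 1)) := by ring
      _ = ‖besselCoeff q l‖ * 8 ^ l * (r ^ l / r ^ (2 * q + 1)) := by rw [e]; ring
      _ ≤ _ := by gcongr
  refine ((OscMul.sum _ h1).congr fun x _ => ?_).mono (by rw [← sum_mul, greenConst])
  unfold _root_.greenKer
  rw [mul_sum]
  refine sum_congr rfl fun l _ => ?_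
  have e : Complex.exp (I * ((σ * x : ℝ) : ℂ) * r) = Complex.exp (I * ((σ * r * x : ℝ) : ℂ)) := by
    congr 1; push_cast; ring
  rw [e]
  push_cast
  ring

lemma omg_sub_le {p s : ℕ} (hs : s ≤ p) {r ρ : ℝ} (hr : 0 < r) (hrρ : r ≤ ρ) :
    omg (p - s) r ≤ omg p r * ρ ^ s := by
  obtain ⟨q, rfl⟩ := Nat.exists_eq_add_of_le hs
  rw [Nat.add_sub_cancel_left]
  unfold omg
  rw [div_mul_eq_mul_div, div_le_div_iff₀ (by positivity) (by positivity)]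
  have h1 : r ^ s * r ^ s ≤ (1 + r) ^ s * ρ ^ s := by gcongr; linarith
  calc (1 + r) ^ q * r ^ (2 * (s + q) + 1) = (1 + r) ^ q * r ^ (2 * q + 1) * (r ^ s * r ^ s) := by
        ring
    _ ≤ (1 + r) ^ q * r ^ (2 * q + 1) * ((1 + r) ^ s * ρ ^ s) := by gcongr
    _ = _ := by ring

lemma one_le_omg_mul {p : ℕ} {r ρ : ℝ} (hr : 0 < r) (hrρ : r ≤ ρ) :
    1 ≤ omg p r * ρ ^ (p + 1) := by
  unfold omg
  rw [div_mul_eq_mul_div, le_div_iff₀ (by positivity), one_mul]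
  calc r ^ (2 * p + 1) = r ^ p * r ^ (p + 1) := by ring
    _ ≤ (1 + r) ^ p * ρ ^ (p + 1) := by gcongr; linarith

lemma hasDerivAt_greenSeq {p : ℕ} {σ : ℝ} (hσ : |σ| = 1) {r : ℝ} (hr : 0 < r) {s : ℕ}
    (hs : s < p + 1) {x : ℝ} (hx : x ≠ 0) :
    HasDerivAt (greenSeq p σ r s) (2 * x * greenSeq p σ r (s + 1) x) x := by
  have hσ2 : σ * σ = 1 := by rw [← abs_mul_abs_self, hσ, one_mul]
  have hx' : (x : ℂ) ≠ 0 := by exact_mod_cast hx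
  have h1 : HasDerivAt (fun x : ℝ => σ * x) σ x := by
    simpa using (hasDerivAt_id x).const_mul σ
  have e : greenSeq p σ r s = fun x => greenKer (p - s) r (σ * x) := by
    ext x; simp [greenSeq, Nat.lt_succ_iff.1 hs]
  rw [e]
  rcases Nat.lt_succ_iff_lt_or_eq.1 hs with h | rfl
  · obtain ⟨q, rfl⟩ : ∃ q, p = s + 1 + q := Nat.exists_eq_add_of_le h
    have e1 : s + 1 + q - s = q + 1 := by omega
    have e2 : s + 1 + q - (s + 1) = q := by omega
    simp only [greenSeq, e1, e2, if_pos (show s + 1 ≤ s + 1 + q by omega)]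
    refine ((hasDerivAt_greenKer_succ q hr.ne' (σ * x)).scomp x h1).congr_deriv ?_
    rw [real_smul]
    have : (σ : ℂ) * σ = 1 := by exact_mod_cast hσ2
    push_cast
    linear_combination (2 * x * greenKer q r (σ * x)) * this
  · simp only [greenSeq, Nat.sub_self, if_neg (show ¬ s + 1 ≤ s by omega)]
    refine ((hasDerivAt_greenKer_zero hr.ne' (σ * x)).scomp x h1).congr_deriv ?_
    rw [real_smul]
    have : Complex.exp (I * ((σ * x : ℝ) : ℂ) * r) = Complex.exp (I * ((σ * r * x : ℝ) : ℂ)) := by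
      congr 1; push_cast; ring
    rw [this]
    field_simp

lemma OscChain.greenSeq (p : ℕ) : ∃ C : ℝ, 0 ≤ C ∧ ∀ σ r ρ : ℝ, |σ| = 1 → 0 < r → r ≤ ρ →
    OscChain (p + 1) ρ (C * omg p r) (fun s => greenKer (p - s) r 0) (greenSeq p σ r) := by
  refine ⟨1 + ∑ q ∈ range (p + 1), greenConst q,
    by have := sum_nonneg (fun q (_ : q ∈ range (p + 1)) => greenConst_nonneg q); linarith,
    fun σ r ρ hσ hr hρ => ?_⟩
  have hw := omg_nonneg p hr.le
  have hS : 0 ≤ ∑ q ∈ range (p + 1), greenConst q := sum_nonneg fun q _ => greenConst_nonneg q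
  have hρ0 : 0 < ρ := hr.trans_le hρ
  have e : ∀ s < p + 1, _root_.greenSeq p σ r s = fun x => _root_.greenKer (p - s) r (σ * x) := by
    intro s hs
    ext x; simp [_root_.greenSeq, Nat.lt_succ_iff.1 hs]
  constructor
  · exact fun s hs x hx => hasDerivAt_greenSeq hσ hr hs hx.1.ne'
  · intro s hs
    rw [e s hs]
    refine (OscMul.greenKer (p - s) hσ hr).mono ?_
    have h1 : greenConst (p - s) ≤ 1 + ∑ q ∈ range (p + 1), greenConst q := by
      have := single_le_sum (f := greenConst) (fun q _ => greenConst_nonneg q)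
        (mem_range.2 (show p - s < p + 1 by omega))
      linarith
    rw [mul_assoc]
    exact mul_le_mul h1 (omg_sub_le (by omega) hr hρ) (omg_nonneg _ hr.le) (by linarith)
  · refine (((OscMul.exp (σ * r)).const_mul (I * σ / 2)).congr fun x hx => ?_).mono ?_
    · have hx' : (x : ℂ) ≠ 0 := by exact_mod_cast hx.1.ne'
      simp only [_root_.greenSeq, if_neg (show ¬ p + 1 ≤ p by omega)]
      field_simp
    · have := one_le_omg_mul (p := p) hr hρ
      simp only [norm_div, norm_mul, Complex.norm_I, Complex.norm_real, Real.norm_eq_abs, hσ,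
        Complex.norm_ofNat, mul_one]
      nlinarith
  · intro s hs
    rw [e s hs]
    have hc : Continuous fun x => _root_.greenKer (p - s) r (σ * x) :=
      (continuous_greenKer _ _).comp (by fun_prop)
    simpa using (hc.tendsto 0).mono_left nhdsWithin_le_nhds

lemma norm_le_of_deriv_bound {f f' : ℝ → ℂ} {C : ℝ} (hd : ∀ x, HasDerivAt f (f' x) x)
    (h0 : f 0 = 0) (hb : ∀ x ∈ Set.Icc (0 : ℝ) 2, ‖f' x‖ ≤ C) :
    ∀ x ∈ Set.Icc (0 : ℝ) 2, ‖f x‖ ≤ C * 2 := by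
  intro x hx
  have hz : (0 : ℝ) ∈ Set.Icc (0 : ℝ) 2 := by simp
  have := (convex_Icc (0 : ℝ) 2).norm_image_sub_le_of_norm_hasDerivWithin_le
    (fun x _ => (hd x).hasDerivWithinAt) hb hz hx
  rw [h0, sub_zero, sub_zero, Real.norm_eq_abs, abs_of_nonneg hx.1] at this
  have hC : 0 ≤ C := (norm_nonneg _).trans (hb 0 hz)
  nlinarith [hx.2]

lemma hasDerivAt_greenKer_sub_zero {r : ℝ} (hr : r ≠ 0) (x : ℝ) :
    HasDerivAt (fun x => greenKer 0 r x - greenKer 0 r (-x))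
      (I * Complex.exp (I * x * r) + I * Complex.exp (I * ((-x : ℝ) : ℂ) * r)) x := by
  refine ((hasDerivAt_greenKer_zero hr x).sub
    ((hasDerivAt_greenKer_zero hr (-x)).scomp x (hasDerivAt_neg x))).congr_deriv ?_
  simp

lemma hasDerivAt_greenKer_sub_succ (q : ℕ) {r : ℝ} (hr : r ≠ 0) (x : ℝ) :
    HasDerivAt (fun x => greenKer (q + 1) r x - greenKer (q + 1) r (-x))
      (2 * x * (greenKer q r x - greenKer q r (-x))) x := by
  refine ((hasDerivAt_greenKer_succ q hr x).sub
    ((hasDerivAt_greenKer_succ q hr (-x)).scomp x (hasDerivAt_neg x))).congr_deriv ?_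
  simp
  ring

lemma norm_exp_I_mul_mul (x r : ℝ) : ‖Complex.exp (I * x * r)‖ = 1 := by
  rw [mul_assoc, mul_comm, ← ofReal_mul]
  exact Complex.norm_exp_ofReal_mul_I _

lemma norm_greenKer_sub_zero_deriv_le (x r : ℝ) :
    ‖I * Complex.exp (I * x * r) + I * Complex.exp (I * ((-x : ℝ) : ℂ) * r)‖ ≤ 2 := by
  refine (norm_add_le _ _).trans ?_
  rw [norm_mul, norm_mul, norm_exp_I_mul_mul, norm_exp_I_mul_mul, Complex.norm_I]
  norm_num

lemma norm_greenKer_sub_le (q : ℕ) : ∃ C : ℝ, 0 ≤ C ∧ ∀ r : ℝ, 0 < r →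
    ∀ x ∈ Set.Icc (0 : ℝ) 2, ‖greenKer q r x - greenKer q r (-x)‖ ≤ C := by
  induction q with
  | zero =>
    refine ⟨4, by norm_num, fun r hr x hx => ?_⟩
    refine (norm_le_of_deriv_bound (hasDerivAt_greenKer_sub_zero hr.ne') (by simp)
      (C := 2) (fun x _ => norm_greenKer_sub_zero_deriv_le x r) x hx).trans (by norm_num)
  | succ q ih =>
    obtain ⟨C, hC, h⟩ := ih
    refine ⟨4 * C * 2, by positivity, fun r hr x hx => ?_⟩
    refine norm_le_of_deriv_bound (hasDerivAt_greenKer_sub_succ q hr.ne') (by simp)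
      (fun x hx => ?_) x hx
    rw [norm_mul, norm_mul, Complex.norm_real, Real.norm_eq_abs, abs_of_nonneg hx.1,
      Complex.norm_ofNat]
    have := h r hr x hx
    have h2 := norm_nonneg (greenKer q r x - greenKer q r (-x))
    nlinarith [hx.1, hx.2]

lemma OscMul.greenKer_sub (q : ℕ) : ∃ C : ℝ, ∀ r : ℝ, 0 < r →
    OscMul (fun x => _root_.greenKer q r x - _root_.greenKer q r (-x)) C := by
  have hc : ∀ q r, Continuous (fun x => _root_.greenKer q r x - _root_.greenKer q r (-x)) :=
    fun q r => (continuous_greenKer q r).sub ((continuous_greenKer q r).comp continuous_neg)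
  obtain ⟨C, hC, h⟩ := norm_greenKer_sub_le q
  cases q with
  | zero =>
    refine ⟨C + 2 * 2, fun r hr => ?_⟩
    exact OscMul.of_deriv (hc 0 r).continuousOn
      (by fun_prop) (fun u _ => hasDerivAt_greenKer_sub_zero hr.ne' u) (h r hr)
      fun u _ => norm_greenKer_sub_zero_deriv_le u r
  | succ q =>
    obtain ⟨C', hC', h'⟩ := norm_greenKer_sub_le q
    refine ⟨C + 2 * (4 * C'), fun r hr => ?_⟩
    refine OscMul.of_deriv (hc (q + 1) r).continuousOn
      (Continuous.continuousOn (Continuous.mul (by fun_prop) (hc q r)))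
      (fun u _ => hasDerivAt_greenKer_sub_succ q hr.ne' u) (h r hr) fun x hx => ?_
    rw [Pi.mul_apply, norm_mul, norm_mul, Complex.norm_real, Real.norm_eq_abs,
      abs_of_nonneg hx.1.le,
      Complex.norm_ofNat]
    have := h' r hr x (Set.Ioo_subset_Icc_self hx)
    have h2 := norm_nonneg (_root_.greenKer q r x - _root_.greenKer q r (-x))
    nlinarith [hx.1, hx.2]

/-- The jump of the free resolvent across the spectrum is a chain with bounds uniform in `r`. -/
lemma OscChain.greenSeq_sub (p : ℕ) : ∃ C : ℝ, 0 ≤ C ∧ ∀ r : ℝ, 0 < r →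
    OscChain (p + 1) 1 C 0
      (fun s x => _root_.greenSeq p 1 r s x - _root_.greenSeq p (-1) r s x) := by
  choose C hC using OscMul.greenKer_sub
  have hC0 : ∀ q, 0 ≤ C q := fun q => (hC q 1 one_pos).nonneg
  have hS : 0 ≤ ∑ q ∈ range (p + 1), C q := sum_nonneg fun q _ => hC0 q
  have e : ∀ s < p + 1, ∀ r, (fun x => _root_.greenSeq p 1 r s x - _root_.greenSeq p (-1) r s x) =
      fun x => _root_.greenKer (p - s) r x - _root_.greenKer (p - s) r (-x) := by
    intro s hs r
    ext x; simp [_root_.greenSeq, Nat.lt_succ_iff.1 hs]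
  refine ⟨1 + ∑ q ∈ range (p + 1), C q, by linarith, fun r hr => ⟨?_, ?_, ?_, ?_⟩⟩
  · intro s hs x hx
    refine ((hasDerivAt_greenSeq (by simp) hr hs hx.1.ne').sub
      (hasDerivAt_greenSeq (by simp) hr hs hx.1.ne')).congr_deriv ?_
    ring
  · intro s hs
    rw [e s hs]
    refine (hC (p - s) r hr).mono ?_
    have := single_le_sum (f := C) (fun q _ => hC0 q) (mem_range.2 (show p - s < p + 1 by omega))
    rw [one_pow, mul_one]
    linarith
  · refine ((((OscMul.exp (1 * r)).const_mul (I / 2)).add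
      ((OscMul.exp ((-1) * r)).const_mul (I / 2))).congr fun x hx => ?_).mono ?_
    · have hx' : (x : ℂ) ≠ 0 := by exact_mod_cast hx.1.ne'
      simp only [_root_.greenSeq, if_neg (show ¬ p + 1 ≤ p by omega)]
      push_cast
      field_simp
      ring
    · simp
      norm_num
      exact hS
  · intro s hs
    rw [e s hs]
    have hc : Continuous fun x => _root_.greenKer (p - s) r x - _root_.greenKer (p - s) r (-x) :=
      (continuous_greenKer _ _).sub ((continuous_greenKer _ _).comp continuous_neg)
    simpa using (hc.tendsto 0).mono_left nhdsWithin_le_nhds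

/-- The iterated Leibniz rule: the divided derivatives of a product of `N` factors. -/
def prodSeq {R : Type*} [CommSemiring R] (u : ℕ → ℕ → R) : ℕ → ℕ → R
  | 0, s => if s = 0 then 1 else 0
  | N + 1, s => leibniz (prodSeq u N) (u N) s

lemma leibniz_zero {R : Type*} [CommSemiring R] (u v : ℕ → R) : leibniz u v 0 = u 0 * v 0 := by
  simp [leibniz]

lemma prodSeq_apply_zero {R : Type*} [CommSemiring R] (u : ℕ → ℕ → R) (N : ℕ) :
    prodSeq u N 0 = ∏ i ∈ range N, u i 0 := by
  induction N with
  | zero => simp [prodSeq]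
  | succ N ih => rw [prodSeq, leibniz_zero, ih, prod_range_succ]

lemma leibniz_sub_leibniz {R : Type*} [CommRing R] (u u' v v' : ℕ → R) (s : ℕ) :
    leibniz u v s - leibniz u' v' s =
      leibniz (fun i => u i - u' i) v s + leibniz u' (fun j => v j - v' j) s := by
  simp only [leibniz, ← sum_sub_distrib, ← sum_add_distrib]
  exact sum_congr rfl fun ij _ => by ring

lemma OscChain.zero (m : ℕ) {ρ : ℝ} : OscChain m ρ 0 0 (fun _ _ => 0) where
  deriv s hs x hx := by simpa using hasDerivAt_const x (0 : ℂ)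
  mul s hs := by simpa using OscMul.const 0
  top := by simpa using OscMul.const 0
  lim s hs := by simp

lemma OscChain.one {m : ℕ} (hm : 0 < m) {ρ : ℝ} (hρ : 0 ≤ ρ) (c : ℕ → ℕ → ℂ)
    (u : ℕ → ℕ → ℝ → ℂ) :
    OscChain m ρ 1 (_root_.prodSeq c 0) (fun s x => _root_.prodSeq (fun i j => u i j x) 0 s) where
  deriv s hs x hx := by
    simp only [_root_.prodSeq]
    simpa using hasDerivAt_const x (if s = 0 then (1 : ℂ) else 0)
  mul s hs := by
    simp only [_root_.prodSeq]
    refine (OscMul.const _).mono ?_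
    split_ifs with h
    · simp [h]
    · simpa using pow_nonneg hρ s
  top := by
    simp only [_root_.prodSeq, hm.ne', if_false, mul_zero]
    refine (OscMul.const _).mono ?_
    simpa using pow_nonneg hρ m
  lim s hs := by
    simp only [_root_.prodSeq]
    exact tendsto_const_nhds

lemma OscChain.prodSeq {m : ℕ} (hm : 0 < m) {ρ : ℝ} (hρ : 0 ≤ ρ) {A : ℕ → ℝ}
    {c : ℕ → ℕ → ℂ} {u : ℕ → ℕ → ℝ → ℂ} (N : ℕ) (h : ∀ i < N, OscChain m ρ (A i) (c i) (u i)) :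
    OscChain m ρ ((4 * 2 ^ m) ^ N * ∏ i ∈ range N, A i) (_root_.prodSeq c N)
      (fun s x => _root_.prodSeq (fun i j => u i j x) N s) := by
  induction N with
  | zero => simpa using OscChain.one hm hρ c u
  | succ N ih =>
    have := (ih fun i hi => h i (by omega)).leibniz hm (h N (by omega))
    refine OscChain.mono hρ this (le_of_eq ?_)
    rw [prod_range_succ, pow_succ]
    ring

/-- The sum over all edges of the product of the weights of the other edges. -/
noncomputable def edgeSum (w : ℕ → ℝ) (N : ℕ) : ℝ :=
  ∑ l ∈ range N, ∏ i ∈ (range N).erase l, w i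

lemma edgeSum_succ (w : ℕ → ℝ) (N : ℕ) :
    edgeSum w (N + 1) = edgeSum w N * w N + ∏ i ∈ range N, w i := by
  unfold edgeSum
  rw [sum_range_succ, sum_mul]
  congr 1
  · refine sum_congr rfl fun l hl => ?_
    have hl' := mem_range.1 hl
    rw [range_add_one, erase_insert_of_ne (by omega), prod_insert (by simp), mul_comm]
  · rw [range_add_one, erase_insert (by simp)]

lemma edgeSum_nonneg {w : ℕ → ℝ} (N : ℕ) (hw : ∀ i < N, 0 ≤ w i) : 0 ≤ edgeSum w N :=
  sum_nonneg fun _ _ => prod_nonneg fun i hi => hw i (mem_range.1 (mem_of_mem_erase hi))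

lemma prod_erase_le_edgeSum {w : ℕ → ℝ} {N l : ℕ} (hw : ∀ i < N, 0 ≤ w i) (hl : l < N) :
    ∏ i ∈ (range N).erase l, w i ≤ edgeSum w N :=
  single_le_sum (f := fun l => ∏ i ∈ (range N).erase l, w i)
    (fun _ _ => prod_nonneg fun i hi => hw i (mem_range.1 (mem_of_mem_erase hi))) (mem_range.2 hl)

/-- Telescoping: a difference of products is controlled by the differences of the factors. -/
lemma OscChain.prodSeq_sub {m : ℕ} (hm : 0 < m) {C : ℝ} (hC : 0 ≤ C) (N : ℕ) :
    ∃ K : ℝ, 0 ≤ K ∧ ∀ (w : ℕ → ℝ) (c : ℕ → ℕ → ℂ) (u v : ℕ → ℕ → ℝ → ℂ),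
      (∀ i < N, 0 ≤ w i) → (∀ i < N, OscChain m 1 (C * w i) (c i) (u i)) →
      (∀ i < N, OscChain m 1 (C * w i) (c i) (v i)) →
      (∀ i < N, OscChain m 1 C 0 (fun s x => u i s x - v i s x)) →
      OscChain m 1 (K * edgeSum w N) 0
        (fun s x => _root_.prodSeq (fun i j => u i j x) N s -
          _root_.prodSeq (fun i j => v i j x) N s) := by
  induction N with
  | zero =>
    refine ⟨0, le_rfl, fun w c u v _ _ _ _ => ?_⟩
    simpa [_root_.prodSeq] using OscChain.zero m
  | succ N ih =>
    obtain ⟨K, hK, h⟩ := ih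
    set L : ℝ := 4 * 2 ^ m with hL
    have hLp : 0 ≤ L := by positivity
    refine ⟨L * (K * C) + L * (L ^ N * C ^ N * C), by positivity, fun w c u v hw hu hv huv => ?_⟩
    have hwN := hw N (by omega)
    have h1 := (h w c u v (fun i hi => hw i (by omega)) (fun i hi => hu i (by omega))
      (fun i hi => hv i (by omega)) (fun i hi => huv i (by omega))).leibniz hm (hu N (by omega))
    have h2 := (OscChain.prodSeq hm zero_le_one N (fun i hi => hv i (by omega))).leibniz hm
      (huv N (by omega))
    have h3 := (h1.add h2)
    have e : (fun s => _root_.leibniz (0 : ℕ → ℂ) (c N) s +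
        _root_.leibniz (_root_.prodSeq c N) (0 : ℕ → ℂ) s) = 0 := by
      ext s; simp [_root_.leibniz]
    rw [e] at h3
    simp only [_root_.prodSeq]
    simp only [leibniz_sub_leibniz]
    refine OscChain.mono zero_le_one h3 ?_
    rw [edgeSum_succ, prod_mul_distrib, prod_const, card_range, ← hL]
    have hE := edgeSum_nonneg N (fun i hi => hw i (by omega))
    have hP : 0 ≤ ∏ i ∈ range N, w i := prod_nonneg fun i hi =>
      hw i (by have := mem_range.1 hi; omega)
    have a1 : 0 ≤ L * (K * C) * ∏ i ∈ range N, w i := by positivity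
    have a2 : 0 ≤ L * (L ^ N * C ^ N * C) * (edgeSum w N * w N) := by positivity
    nlinarith

/-- The successive derivatives of a smooth function with respect to `x ^ 2`. -/
noncomputable def divDeriv (f : ℝ → ℂ) : ℕ → ℝ → ℂ
  | 0 => f
  | s + 1 => fun x => deriv (divDeriv f s) x / (2 * x)

lemma divDeriv_spec {f : ℝ → ℂ} {a b : ℝ} {k : ℂ} (ha : 0 < a) (hf : ContDiff ℝ (⊤ : ℕ∞) f)
    (hfa : ∀ x < a, f x = k) (hfb : ∀ x > b, f x = 0) (s : ℕ) :
    ContDiff ℝ (⊤ : ℕ∞) (divDeriv f s) ∧ (∃ k, ∀ x < a, divDeriv f s x = k) ∧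
      ∀ x > b, divDeriv f s x = 0 := by
  induction s with
  | zero => exact ⟨hf, ⟨k, hfa⟩, hfb⟩
  | succ s ih =>
    obtain ⟨h1, ⟨k', h2⟩, h3⟩ := ih
    have h4 : ∀ x < a, divDeriv f (s + 1) x = 0 := by
      intro x hx
      have : divDeriv f s =ᶠ[nhds x] fun _ => k' := by
        filter_upwards [Iio_mem_nhds hx] with y hy using h2 y hy
      simp [divDeriv, this.deriv_eq]
    refine ⟨?_, ⟨0, h4⟩, ?_⟩
    · rw [contDiff_iff_contDiffAt]
      intro x
      by_cases hx : x = 0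
      · refine (contDiffAt_const (c := (0 : ℂ))).congr_of_eventuallyEq ?_
        filter_upwards [Iio_mem_nhds (hx ▸ ha)] with y hy using h4 y hy
      · have h5 : ContDiff ℝ (⊤ : ℕ∞) (deriv (divDeriv f s)) :=
          (contDiff_infty_iff_deriv.1 h1).2
        have h6 : ContDiff ℝ (⊤ : ℕ∞) (fun x : ℝ => 2 * (x : ℂ)) :=
          contDiff_const.mul ofRealCLM.contDiff
        have h7 : (2 * (x : ℂ)) ≠ 0 := by simpa using hx
        exact h5.contDiffAt.mul (h6.contDiffAt.inv h7)
    · intro x hx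
      have : divDeriv f s =ᶠ[nhds x] fun _ => 0 := by
        filter_upwards [Ioi_mem_nhds hx] with y hy using h3 y hy
      simp [divDeriv, this.deriv_eq]

lemma OscChain.divDeriv {f : ℝ → ℂ} {a b : ℝ} {k : ℂ} (ha : 0 < a) (hf : ContDiff ℝ (⊤ : ℕ∞) f)
    (hfa : ∀ x < a, f x = k) (hfb : ∀ x > b, f x = 0) (m : ℕ) :
    ∃ C : ℝ, 0 ≤ C ∧ ∀ ρ : ℝ, 1 ≤ ρ →
      OscChain m ρ C (fun s => _root_.divDeriv f s 0) (_root_.divDeriv f) := by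
  have hs := divDeriv_spec ha hf hfa hfb
  have hB : ∀ s, ∃ B, OscMul (_root_.divDeriv f s) B := fun s =>
    OscMul.of_contDiff ((hs s).1.of_le (by exact_mod_cast le_top))
  choose B hB using hB
  have hB0 : ∀ s, 0 ≤ B s := fun s => (hB s).nonneg
  have hle : ∀ s ≤ m, 4 * B s ≤ ∑ s ∈ range (m + 1), 4 * B s := fun s hs =>
    single_le_sum (f := fun s => 4 * B s) (fun i _ => by have := hB0 i; positivity)
      (mem_range.2 (by omega))
  have hC : 0 ≤ ∑ s ∈ range (m + 1), 4 * B s :=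
    sum_nonneg fun i _ => by have := hB0 i; positivity
  refine ⟨_, hC, fun ρ hρ => ⟨?_, ?_, ?_, ?_⟩⟩
  · intro s _ x hx
    have hx' : (x : ℂ) ≠ 0 := by exact_mod_cast hx.1.ne'
    refine (((hs s).1.differentiable (by simp)) x).hasDerivAt.congr_deriv ?_
    simp only [_root_.divDeriv]
    field_simp
  · intro s hsm
    refine (hB s).mono ?_
    have := le_mul_of_one_le_right hC (one_le_pow₀ hρ (n := s))
    have := hle s hsm.le
    have := hB0 s
    linarith
  · refine (OscMul.id.mul (hB m)).mono ?_
    have := le_mul_of_one_le_right hC (one_le_pow₀ hρ (n := m))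
    have := hle m le_rfl
    linarith
  · intro s _
    exact ((hs s).1.continuous.tendsto 0).mono_left nhdsWithin_le_nhds

lemma omg_mul_pow_le (p : ℕ) {r : ℝ} (hr : 1 ≤ r) : omg p r * r ^ (p + 1) ≤ 2 ^ p := by
  have h0 : 0 < r := by linarith
  unfold omg
  rw [div_mul_eq_mul_div, div_le_iff₀ (by positivity)]
  calc (1 + r) ^ p * r ^ (p + 1) ≤ (2 * r) ^ p * r ^ (p + 1) := by gcongr; linarith
    _ = _ := by ring

/-- A vanishing chain multiplied by a cutoff has a decaying oscillatory integral. -/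
lemma OscChain.norm_integral_cutoff_le {m : ℕ} (hm : 0 < m) {ρ A B b : ℝ} (hb : b < 2)
    {d : ℕ → ℂ} {v u : ℕ → ℝ → ℂ} (hv : OscChain m ρ B d v) (hvb : ∀ s, ∀ x > b, v s x = 0)
    (hu : OscChain m ρ A 0 u) {t : ℝ} (ht : t ≠ 0) :
    ‖∫ x in (0 : ℝ)..2, Complex.exp (I * t * (x : ℂ) ^ 2) * (x * (v 0 x * u 0 x))‖ ≤
      6 * (4 * 2 ^ m * (B * A) * ρ ^ m) * |t| ^ (-(2 * (m : ℝ) + 1) / 2) := by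
  have h := hv.leibniz hm hu
  have e : _root_.leibniz d (0 : ℕ → ℂ) = 0 := by ext s; simp [_root_.leibniz]
  rw [e] at h
  have := h.norm_integral_le hm (fun s _ => ?_) t ht
  · simpa only [leibniz_zero] using this
  · filter_upwards [mem_nhdsWithin_of_mem_nhds (Ioi_mem_nhds hb)] with x hx
    exact sum_eq_zero fun ij _ => by simp [hvb _ x hx]

/-- The oscillatory bound for the jump of a product of free resolvent kernels. -/
lemma exists_norm_integral_greenKer_le (p N : ℕ) {f : ℝ → ℂ} {a b : ℝ} {k : ℂ} (ha : 0 < a)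
    (hb : b < 2) (hf : ContDiff ℝ (⊤ : ℕ∞) f) (hfa : ∀ x < a, f x = k)
    (hfb : ∀ x > b, f x = 0) :
    ∃ C : ℝ, 0 ≤ C ∧ ∀ r : ℕ → ℝ, (∀ i < N, 0 < r i) → ∀ t : ℝ, t ≠ 0 →
      ‖∫ x in (0 : ℝ)..2, Complex.exp (I * t * (x : ℂ) ^ 2) * (x * (f x *
        (∏ i ∈ range N, greenKer p (r i) x - ∏ i ∈ range N, greenKer p (r i) (-x))))‖ ≤
      C * edgeSum (fun i => omg p (r i)) N * |t| ^ (-(2 * ((p + 1 : ℕ) : ℝ) + 1) / 2) := by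
  obtain ⟨B, hB, hχ⟩ := OscChain.divDeriv ha hf hfa hfb (p + 1)
  have hvb : ∀ s, ∀ x > b, divDeriv f s x = 0 := fun s => (divDeriv_spec ha hf hfa hfb s).2.2
  obtain ⟨C1, hC1, h1⟩ := OscChain.greenSeq p
  obtain ⟨C2, hC2, h2⟩ := OscChain.greenSeq_sub p
  obtain ⟨K, hK, h3⟩ := OscChain.prodSeq_sub (m := p + 1) (by omega) (add_nonneg hC1 hC2) N
  set L : ℝ := 4 * 2 ^ (p + 1) with hL
  have hLp : 0 ≤ L := by positivity
  refine ⟨6 * (L * (B * K)) + 6 * (L * (B * (L ^ N * C1 ^ N * 2 * 2 ^ p))), by positivity,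
    fun r hr t ht => ?_⟩
  have hω : ∀ i < N, 0 ≤ omg p (r i) := fun i hi => omg_nonneg p (hr i hi).le
  have hW := edgeSum_nonneg N hω
  have ev : ∀ x : ℝ, ∏ i ∈ range N, greenKer p (r i) x - ∏ i ∈ range N, greenKer p (r i) (-x) =
      prodSeq (fun i j => greenSeq p 1 (r i) j x) N 0 -
        prodSeq (fun i j => greenSeq p (-1) (r i) j x) N 0 := by
    intro x
    simp [prodSeq_apply_zero, greenSeq]
  simp only [ev]
  by_cases hr1 : ∀ i < N, r i ≤ 1
  · have h4 := h3 (fun i => omg p (r i)) (fun i s => greenKer (p - s) (r i) 0)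
      (fun i => greenSeq p 1 (r i)) (fun i => greenSeq p (-1) (r i)) hω
      (fun i hi => (h1 1 (r i) 1 (by simp) (hr i hi) (hr1 i hi)).mono zero_le_one
        (by have := hω i hi; nlinarith))
      (fun i hi => (h1 (-1) (r i) 1 (by simp) (hr i hi) (hr1 i hi)).mono zero_le_one
        (by have := hω i hi; nlinarith))
      (fun i hi => (h2 (r i) (hr i hi)).mono zero_le_one (by linarith))
    refine (OscChain.norm_integral_cutoff_le (by omega) hb (hχ 1 le_rfl) hvb h4 ht).trans ?_
    rw [one_pow, mul_one, ← hL]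
    refine mul_le_mul_of_nonneg_right ?_ (by positivity)
    have : 0 ≤ 6 * (L * (B * (L ^ N * C1 ^ N * 2 * 2 ^ p))) * edgeSum (fun i => omg p (r i)) N := by
      positivity
    nlinarith
  · push Not at hr1
    obtain ⟨j, hj, hj1⟩ := hr1
    obtain ⟨l, hl, hmax⟩ := exists_max_image (range N) r ⟨j, mem_range.2 hj⟩
    have hlN := mem_range.1 hl
    have hl1 : 1 ≤ r l := hj1.le.trans (hmax j (mem_range.2 hj))
    have hl0 : 0 ≤ r l := by linarith
    have hch : ∀ σ : ℝ, |σ| = 1 → OscChain (p + 1) (r l)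
        ((4 * 2 ^ (p + 1)) ^ N * ∏ i ∈ range N, (C1 * omg p (r i)))
        (prodSeq (fun i s => greenKer (p - s) (r i) 0) N)
        (fun s x => prodSeq (fun i j => greenSeq p σ (r i) j x) N s) := fun σ hσ =>
      OscChain.prodSeq (by omega) hl0 N fun i hi =>
        h1 σ (r i) (r l) hσ (hr i hi) (hmax i (mem_range.2 hi))
    have h4 := (hch 1 (by simp)).add (hch (-1) (by simp)).neg
    have e : (fun s => prodSeq (fun i s => greenKer (p - s) (r i) 0) N s +
        -prodSeq (fun i s => greenKer (p - s) (r i) 0) N s) = 0 := by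
      ext s; simp
    rw [e] at h4
    refine le_trans (le_of_eq ?_) ((OscChain.norm_integral_cutoff_le (by omega) hb (hχ _ hl1)
      hvb h4 ht).trans ?_)
    · simp only [divDeriv, sub_eq_add_neg]
    rw [← hL, prod_mul_distrib, prod_const, card_range]
    refine mul_le_mul_of_nonneg_right ?_ (by positivity)
    have h5 : (∏ i ∈ range N, omg p (r i)) * r l ^ (p + 1) ≤
        2 ^ p * edgeSum (fun i => omg p (r i)) N := by
      rw [← mul_prod_erase _ _ hl]
      have a1 := omg_mul_pow_le p hl1
      have a2 := prod_erase_le_edgeSum (w := fun i => omg p (r i)) hω hlN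
      have a3 : 0 ≤ ∏ i ∈ (range N).erase l, omg p (r i) :=
        prod_nonneg fun i hi => hω i (mem_range.1 (mem_of_mem_erase hi))
      calc _ = (omg p (r l) * r l ^ (p + 1)) * ∏ i ∈ (range N).erase l, omg p (r i) := by ring
        _ ≤ 2 ^ p * edgeSum (fun i => omg p (r i)) N := by gcongr
    have h6 : 0 ≤ 6 * (L * (B * K)) * edgeSum (fun i => omg p (r i)) N := by positivity
    have h7 := mul_le_mul_of_nonneg_left h5
      (show 0 ≤ 6 * (L * (B * (L ^ N * C1 ^ N * 2))) by positivity)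
    calc _ = 6 * (L * (B * (L ^ N * C1 ^ N * 2))) * ((∏ i ∈ range N, omg p (r i)) *
          r l ^ (p + 1)) := by ring
      _ ≤ _ := h7
      _ ≤ _ := by linarith

section Chain

variable {n : ℕ}

lemma lintegral_pi_insertNth {α : Type*} [MeasureSpace α] [SigmaFinite (volume : Measure α)]
    {k : ℕ} (i : Fin (k + 1)) {G : (Fin (k + 1) → α) → ENNReal} (hG : Measurable G) :
    ∫⁻ z, G z = ∫⁻ a, ∫⁻ z', G (i.insertNth (α := fun _ => α) a z') := by
  have h := (volume_preserving_piFinSuccAbove (fun _ : Fin (k + 1) => α) i).symm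
  rw [← h.lintegral_comp hG]
  exact lintegral_prod _ (hG.comp (MeasurableEquiv.measurable _)).aemeasurable

lemma chainPt_cons {k : ℕ} (x y a : EuclideanSpace ℝ (Fin n))
    (z : Fin k → EuclideanSpace ℝ (Fin n)) (j : ℕ) :
    chainPt x y (Fin.cons a z : Fin (k + 1) → _) (j + 1) = chainPt a y z j := by
  unfold chainPt
  rcases j with _ | j
  · simp
  · simp only [Nat.add_sub_cancel, Nat.succ_ne_zero, if_false, Nat.succ_lt_succ_iff]
    split_ifs with h
    · exact Fin.cons_succ (α := fun _ => EuclideanSpace ℝ (Fin n)) a z ⟨j, h⟩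
    · rfl

lemma chainPt_snoc {k : ℕ} (x y a : EuclideanSpace ℝ (Fin n))
    (z : Fin k → EuclideanSpace ℝ (Fin n)) {j : ℕ} (hj : j ≤ k + 1) :
    chainPt x y (Fin.snoc z a : Fin (k + 1) → _) j = chainPt x a z j := by
  unfold chainPt
  split_ifs with h0 h1 h2 h2
  · rfl
  · simp [Fin.snoc, h2]
  · simp [Fin.snoc, h2]
  · omega
  · omega

lemma chainPt_zero {k : ℕ} (x y : EuclideanSpace ℝ (Fin n))
    (z : Fin k → EuclideanSpace ℝ (Fin n)) : chainPt x y z 0 = x := by simp [chainPt]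

lemma chainPt_last {k : ℕ} (x y : EuclideanSpace ℝ (Fin n))
    (z : Fin k → EuclideanSpace ℝ (Fin n)) : chainPt x y z (k + 1) = y := by simp [chainPt]

lemma measurable_chainPt {β : Type*} [MeasurableSpace β] {k : ℕ}
    {f g : β → EuclideanSpace ℝ (Fin n)} {h : β → Fin k → EuclideanSpace ℝ (Fin n)}
    (hf : Measurable f) (hg : Measurable g) (hh : Measurable h) (j : ℕ) :
    Measurable fun b => chainPt (f b) (g b) (h b) j := by
  unfold chainPt
  split_ifs with h0 h1
  · exact hf
  · exact (measurable_pi_apply _).comp hh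
  · exact hg

variable {w : EuclideanSpace ℝ (Fin n) → EuclideanSpace ℝ (Fin n) → ENNReal}
  {v : EuclideanSpace ℝ (Fin n) → ENNReal}

lemma measurable_chainProd {β : Type*} [MeasurableSpace β] {k : ℕ} (s : Finset ℕ)
    (hw : Measurable (Function.uncurry w)) (hv : Measurable v)
    {f g : β → EuclideanSpace ℝ (Fin n)} {h : β → Fin k → EuclideanSpace ℝ (Fin n)}
    (hf : Measurable f) (hg : Measurable g) (hh : Measurable h) :
    Measurable fun b => (∏ i ∈ s, w (chainPt (f b) (g b) (h b) i)
      (chainPt (f b) (g b) (h b) (i + 1))) * ∏ j, v (h b j) := by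
  refine Measurable.mul ?_ ?_
  · exact Finset.measurable_fun_prod _ fun i _ => hw.comp
      ((measurable_chainPt hf hg hh i).prodMk (measurable_chainPt hf hg hh (i + 1)))
  · exact Finset.measurable_fun_prod _ fun j _ => hv.comp ((measurable_pi_apply j).comp hh)

lemma measurable_chainProd_const {k : ℕ} (s : Finset ℕ)
    (hw : Measurable (Function.uncurry w)) (hv : Measurable v) (a b : EuclideanSpace ℝ (Fin n)) :
    Measurable fun z : Fin k → EuclideanSpace ℝ (Fin n) =>
      (∏ i ∈ s, w (chainPt a b z i) (chainPt a b z (i + 1))) * ∏ j, v (z j) :=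
  measurable_chainProd s hw hv measurable_const measurable_const measurable_id

/-- A chain integral with one edge removed is bounded uniformly in the end points. -/
lemma lintegral_chain_erase_le (hw : Measurable (Function.uncurry w)) (hv : Measurable v)
    {κ : ENNReal} (h1 : ∀ x, ∫⁻ z, w x z * v z ≤ κ) (h2 : ∀ x, ∫⁻ z, w z x * v z ≤ κ)
    (k l : ℕ) (hl : l ≤ k) (x y : EuclideanSpace ℝ (Fin n)) :
    ∫⁻ z : Fin k → EuclideanSpace ℝ (Fin n), (∏ i ∈ (range (k + 1)).erase l,
      w (chainPt x y z i) (chainPt x y z (i + 1))) * ∏ j, v (z j) ≤ κ ^ k := by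
  induction k generalizing l x y with
  | zero =>
    obtain rfl : l = 0 := by omega
    simp [volume_pi]
  | succ k ih =>
    rcases l with _ | l
    · rw [lintegral_pi_insertNth (Fin.last k) (measurable_chainProd_const _ hw hv x y)]
      have e : ∀ a (z : Fin k → EuclideanSpace ℝ (Fin n)),
          (∏ i ∈ (range (k + 1 + 1)).erase 0, w (chainPt x y (Fin.snoc z a : Fin (k + 1) → _) i)
            (chainPt x y (Fin.snoc z a : Fin (k + 1) → _) (i + 1))) *
            ∏ j, v ((Fin.snoc z a : Fin (k + 1) → _) j) =
          (w a y * v a) * ((∏ i ∈ (range (k + 1)).erase 0,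
            w (chainPt x a z i) (chainPt x a z (i + 1))) * ∏ j, v (z j)) := by
        intro a z
        rw [range_add_one (n := k + 1), erase_insert_of_ne (by omega), prod_insert (by simp),
          chainPt_last, chainPt_snoc _ _ _ _ le_rfl, chainPt_last, Fin.prod_univ_castSucc]
        simp only [Fin.snoc_castSucc, Fin.snoc_last]
        rw [prod_congr rfl fun i hi => ?_]
        · ring
        · have := mem_range.1 (mem_of_mem_erase hi)
          rw [chainPt_snoc _ _ _ _ (by omega), chainPt_snoc _ _ _ _ (by omega)]
      simp only [Fin.insertNth_last', e]
      calc _ ≤ ∫⁻ a, w a y * v a * κ ^ k := lintegral_mono fun a => by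
            rw [lintegral_const_mul _ (measurable_chainProd_const _ hw hv x a)]
            gcongr
            exact ih 0 (by omega) x a
        _ ≤ κ ^ (k + 1) := by
            have hm : Measurable fun a => w a y * v a :=
              (hw.comp (measurable_id.prodMk measurable_const)).mul hv
            rw [lintegral_mul_const _ hm,
              pow_succ, mul_comm]
            gcongr
            exact h2 y
    · rw [lintegral_pi_insertNth 0 (measurable_chainProd_const _ hw hv x y)]
      have e : ∀ a (z : Fin k → EuclideanSpace ℝ (Fin n)),
          (∏ i ∈ (range (k + 1 + 1)).erase (l + 1),
            w (chainPt x y (Fin.cons a z : Fin (k + 1) → _) i)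
            (chainPt x y (Fin.cons a z : Fin (k + 1) → _) (i + 1))) *
            ∏ j, v ((Fin.cons a z : Fin (k + 1) → _) j) =
          (w x a * v a) * ((∏ i ∈ (range (k + 1)).erase l,
            w (chainPt a y z i) (chainPt a y z (i + 1))) * ∏ j, v (z j)) := by
        intro a z
        have hs : (range (k + 1 + 1)).erase (l + 1) =
            insert 0 (((range (k + 1)).erase l).map ⟨Nat.succ, Nat.succ_injective⟩) := by
          ext i
          rcases i with _ | i
          · simp
          · simp
        rw [hs, prod_insert (by simp), prod_map, chainPt_cons, chainPt_zero, chainPt_zero,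
          Fin.prod_univ_succ]
        simp only [Fin.cons_zero, Fin.cons_succ, Function.Embedding.coeFn_mk, Nat.succ_eq_add_one,
          chainPt_cons]
        ring
      simp only [Fin.insertNth_zero', e]
      calc _ ≤ ∫⁻ a, w x a * v a * κ ^ k := lintegral_mono fun a => by
            rw [lintegral_const_mul _ (measurable_chainProd_const _ hw hv a y)]
            gcongr
            exact ih l (by omega) a y
        _ ≤ κ ^ (k + 1) := by
            have hm : Measurable fun a => w x a * v a :=
              (hw.comp (measurable_const.prodMk measurable_id)).mul hv
            rw [lintegral_mul_const _ hm,
              pow_succ, mul_comm]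
            gcongr
            exact h1 x

/-- The full chain integral, averaged over one end point. -/
lemma lintegral_chain_le (hw : Measurable (Function.uncurry w)) (hv : Measurable v)
    {κ : ENNReal} (h1 : ∀ x, ∫⁻ z, w x z * v z ≤ κ) (h2 : ∀ x, ∫⁻ z, w z x * v z ≤ κ)
    (k : ℕ) (x : EuclideanSpace ℝ (Fin n)) :
    ∫⁻ y, v y * ∫⁻ z : Fin k → EuclideanSpace ℝ (Fin n), (∏ i ∈ range (k + 1),
      w (chainPt x y z i) (chainPt x y z (i + 1))) * ∏ j, v (z j) ≤ κ ^ (k + 1) := by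
  have h := lintegral_chain_erase_le hw hv h1 h2 (k + 1) (k + 1) le_rfl x x
  rw [lintegral_pi_insertNth (Fin.last k)
    (measurable_chainProd_const _ hw hv x x)] at h
  refine le_trans (le_of_eq (lintegral_congr fun a => ?_)) h
  rw [← lintegral_const_mul _
    (measurable_chainProd_const _ hw hv x a)]
  refine lintegral_congr fun z => ?_
  simp only [Fin.insertNth_last', Fin.prod_univ_castSucc, Fin.snoc_castSucc, Fin.snoc_last]
  rw [range_add_one (n := k + 1), erase_insert (by simp)]
  rw [prod_congr (s₁ := range (k + 1)) rfl (fun i hi => ?_)]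
  · ring
  · have := mem_range.1 hi
    rw [chainPt_snoc _ _ _ _ (by omega), chainPt_snoc _ _ _ _ (by omega)]

end Chain

lemma inv_pow_mul_inv_pow_le {a b : ℝ} (ha : 0 < a) (hb : 0 < b) (i j : ℕ) :
    (a ^ i)⁻¹ * (b ^ j)⁻¹ ≤ (a ^ (i + j))⁻¹ + (b ^ (i + j))⁻¹ := by
  have ha' : 0 ≤ (a ^ (i + j))⁻¹ := by positivity
  have hb' : 0 ≤ (b ^ (i + j))⁻¹ := by positivity
  rcases le_total a b with h | h
  · have : (a ^ i)⁻¹ * (b ^ j)⁻¹ ≤ (a ^ (i + j))⁻¹ := by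
      rw [pow_add, mul_inv]
      gcongr
    linarith
  · have : (a ^ i)⁻¹ * (b ^ j)⁻¹ ≤ (b ^ (i + j))⁻¹ := by
      rw [pow_add, mul_inv]
      gcongr
    linarith

lemma omg_mul_le (p : ℕ) {r s : ℝ} (hr : 0 ≤ r) (hs : 0 ≤ s) :
    omg p r * ((1 + s) ^ (p + 3))⁻¹ ≤
      Set.indicator (Set.Iio 1) (fun r => 2 ^ p * (r ^ (2 * p + 1))⁻¹) r +
        2 ^ (2 * p + 1) * (((1 + r) ^ (2 * p + 4))⁻¹ + ((1 + s) ^ (2 * p + 4))⁻¹) := by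
  by_cases h : r < 1
  · rw [Set.indicator_of_mem (Set.mem_Iio.2 h)]
    have h1 : omg p r * ((1 + s) ^ (p + 3))⁻¹ ≤ 2 ^ p * (r ^ (2 * p + 1))⁻¹ * 1 := by
      unfold omg
      rw [div_eq_mul_inv]
      gcongr
      · linarith
      · exact inv_le_one_of_one_le₀ (one_le_pow₀ (by linarith))
    have h2 : 0 ≤ 2 ^ (2 * p + 1) * (((1 + r) ^ (2 * p + 4))⁻¹ + ((1 + s) ^ (2 * p + 4))⁻¹) := by
      positivity
    linarith
  · rw [Set.indicator_of_notMem (by simpa using h), zero_add]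
    push Not at h
    have h1 : omg p r ≤ 2 ^ (2 * p + 1) * ((1 + r) ^ (p + 1))⁻¹ := by
      unfold omg
      rw [← div_eq_mul_inv, div_le_div_iff₀ (by positivity) (by positivity)]
      calc (1 + r) ^ p * (1 + r) ^ (p + 1) = (1 + r) ^ (2 * p + 1) := by ring
        _ ≤ (2 * r) ^ (2 * p + 1) := by gcongr; linarith
        _ = _ := by rw [mul_pow]
    have h2 := inv_pow_mul_inv_pow_le (show 0 < 1 + r by linarith) (show 0 < 1 + s by linarith)
      (p + 1) (p + 3)
    rw [show p + 1 + (p + 3) = 2 * p + 4 by ring] at h2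
    calc _ ≤ 2 ^ (2 * p + 1) * ((1 + r) ^ (p + 1))⁻¹ * ((1 + s) ^ (p + 3))⁻¹ := by gcongr
      _ = 2 ^ (2 * p + 1) * (((1 + r) ^ (p + 1))⁻¹ * ((1 + s) ^ (p + 3))⁻¹) := by ring
      _ ≤ _ := by gcongr

lemma measurable_omg (p : ℕ) : Measurable (omg p) := by unfold omg; fun_prop

lemma integrable_indicator_norm (p : ℕ) :
    Integrable (fun z : EuclideanSpace ℝ (Fin (2 * p + 3)) =>
      Set.indicator (Set.Iio (1 : ℝ)) (fun r => 2 ^ p * (r ^ (2 * p + 1))⁻¹) ‖z‖) := by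
  rw [integrable_fun_norm_addHaar volume
    (f := Set.indicator (Set.Iio (1 : ℝ)) (fun r => 2 ^ p * (r ^ (2 * p + 1))⁻¹))]
  have h1 : IntegrableOn (fun y : ℝ => (2 : ℝ) ^ p * y) (Set.Ioo 0 1) :=
    (Continuous.integrableOn_Icc (by fun_prop)).mono_set Set.Ioo_subset_Icc_self
  have h2 := (integrable_indicator_iff measurableSet_Ioo).2 h1
  refine h2.integrableOn.congr_fun (fun y hy => ?_) measurableSet_Ioi
  have hy0 : 0 < y := hy
  simp only [finrank_euclideanSpace, Fintype.card_fin, smul_eq_mul]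
  by_cases h : y < 1
  · rw [Set.indicator_of_mem (show y ∈ Set.Ioo 0 1 from ⟨hy0, h⟩),
      Set.indicator_of_mem (Set.mem_Iio.2 h),
      show 2 * p + 3 - 1 = 2 * p + 1 + 1 by omega]
    field_simp
    ring
  · rw [Set.indicator_of_notMem (fun h' => h h'.2), Set.indicator_of_notMem (by simpa using h),
      mul_zero]

lemma integrable_inv_one_add_norm_pow (p : ℕ) :
    Integrable (fun z : EuclideanSpace ℝ (Fin (2 * p + 3)) => ((1 + ‖z‖) ^ (2 * p + 4))⁻¹) := by
  have h := integrable_one_add_norm (E := EuclideanSpace ℝ (Fin (2 * p + 3))) (μ := volume)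
    (r := ((2 * p + 4 : ℕ) : ℝ)) (by
      rw [finrank_euclideanSpace, Fintype.card_fin]; exact_mod_cast Nat.lt_succ_self _)
  refine h.congr (Filter.Eventually.of_forall fun z => ?_)
  simp only
  rw [Real.rpow_neg (by positivity), Real.rpow_natCast]

/-- The weighted potential bound for a single resolvent edge. -/
lemma exists_lintegral_omg_le (p : ℕ) : ∃ κ : ENNReal, κ ≠ ⊤ ∧
    ∀ x : EuclideanSpace ℝ (Fin (2 * p + 3)),
      ∫⁻ z, ENNReal.ofReal (omg p ‖x - z‖) * ENNReal.ofReal ((1 + ‖z‖) ^ (p + 3))⁻¹ ≤ κ := by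
  set F : EuclideanSpace ℝ (Fin (2 * p + 3)) → ℝ := fun z =>
    Set.indicator (Set.Iio (1 : ℝ)) (fun r => 2 ^ p * (r ^ (2 * p + 1))⁻¹) ‖z‖ with hF
  set G : EuclideanSpace ℝ (Fin (2 * p + 3)) → ℝ := fun z => ((1 + ‖z‖) ^ (2 * p + 4))⁻¹ with hG
  have hF0 : ∀ z, 0 ≤ F z := fun z => by
    simp only [hF, Set.indicator_apply]
    split_ifs <;> positivity
  have hG0 : ∀ z, 0 ≤ G z := fun z => by positivity
  have hH : Integrable (fun z => F z + 2 ^ (2 * p + 1) * G z) :=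
    (integrable_indicator_norm p).add ((integrable_inv_one_add_norm_pow p).const_mul _)
  have hG' : Integrable (fun z => 2 ^ (2 * p + 1) * G z) :=
    (integrable_inv_one_add_norm_pow p).const_mul _
  refine ⟨(∫⁻ z, ENNReal.ofReal (F z + 2 ^ (2 * p + 1) * G z)) +
    ∫⁻ z, ENNReal.ofReal (2 ^ (2 * p + 1) * G z), ?_, fun x => ?_⟩
  · exact ENNReal.add_ne_top.2 ⟨hH.lintegral_lt_top.ne, hG'.lintegral_lt_top.ne⟩
  · rw [← lintegral_sub_left_eq_self (fun z => ENNReal.ofReal (F z + 2 ^ (2 * p + 1) * G z)) x,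
      ← lintegral_add_right' _ hG'.aestronglyMeasurable.aemeasurable.ennreal_ofReal]
    refine lintegral_mono fun z => ?_
    rw [← ENNReal.ofReal_mul (omg_nonneg p (norm_nonneg _)), ← ENNReal.ofReal_add]
    · refine ENNReal.ofReal_le_ofReal ((omg_mul_le p (norm_nonneg _) (norm_nonneg _)).trans ?_)
      simp only [hF, hG]
      linarith
    · have := hF0 (x - z); have := hG0 (x - z); positivity
    · have := hG0 z; positivity

lemma greenKer_zero_left (p : ℕ) (x : ℝ) : greenKer p 0 x = 0 := by simp [greenKer]

lemma norm_greenKer_eq (p : ℕ) {r : ℝ} (hr : 0 ≤ r) (x : ℝ) :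
    ‖greenKer p r x‖ = ‖∑ l ∈ range (p + 1), besselCoeff p l * ((-2) * I * r * x) ^ l‖ /
      r ^ (2 * p + 1) := by
  rw [greenKer, norm_mul, norm_div, norm_exp_I_mul_mul, norm_pow, Complex.norm_real,
    Real.norm_eq_abs, abs_of_nonneg hr]
  ring

lemma exists_norm_greenKer_le (p : ℕ) : ∃ C : ℝ, 0 ≤ C ∧ ∀ r x : ℝ, 0 ≤ r → |x| ≤ 1 →
    ‖greenKer p r x‖ ≤ C * omg p r := by
  refine ⟨∑ l ∈ range (p + 1), ‖besselCoeff p l‖ * 2 ^ l,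
    sum_nonneg fun _ _ => by positivity, fun r x hr hx => ?_⟩
  rw [norm_greenKer_eq p hr, omg, ← mul_div_assoc]
  refine div_le_div_of_nonneg_right ((norm_sum_le _ _).trans ?_) (by positivity)
  rw [sum_mul]
  refine sum_le_sum fun l hl => ?_
  have hl' : l ≤ p := Nat.lt_succ_iff.1 (mem_range.1 hl)
  have e : ‖(-2) * I * (r : ℂ) * x‖ = 2 * (r * |x|) := by
    simp [abs_of_nonneg hr]
    ring
  rw [norm_mul, norm_pow, e, mul_assoc, mul_pow]
  gcongr
  calc (r * |x|) ^ l ≤ (1 + r) ^ l := by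
        gcongr
        nlinarith [abs_nonneg x]
    _ ≤ (1 + r) ^ p := pow_le_pow_right₀ (by linarith) hl'

lemma exists_norm_greenKer_ge (p : ℕ) : ∃ δ c : ℝ, 0 < δ ∧ δ ≤ 1 ∧ 0 < c ∧ ∀ r x : ℝ, 0 ≤ r →
    r < δ → |x| ≤ 1 → c / r ^ (2 * p + 1) ≤ ‖greenKer p r x‖ := by
  have hc : 0 < ‖besselCoeff p 0‖ := by
    rw [norm_pos_iff, besselCoeff]
    exact div_ne_zero (by exact_mod_cast Nat.factorial_ne_zero _)
      (mul_ne_zero (by exact_mod_cast Nat.factorial_ne_zero _)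
        (by exact_mod_cast Nat.factorial_ne_zero _))
  have hcont : Continuous fun y : ℝ =>
      ‖∑ l ∈ range (p + 1), besselCoeff p l * ((-2) * I * (y : ℂ)) ^ l‖ := by fun_prop
  have h0 : ‖∑ l ∈ range (p + 1), besselCoeff p l * ((-2) * I * ((0 : ℝ) : ℂ)) ^ l‖ =
      ‖besselCoeff p 0‖ := by
    rw [sum_range_succ']
    simp
  have hev : ∀ᶠ y : ℝ in nhds (0 : ℝ), ‖besselCoeff p 0‖ / 2 <
      ‖∑ l ∈ range (p + 1), besselCoeff p l * ((-2) * I * (y : ℂ)) ^ l‖ :=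
    (hcont.tendsto 0).eventually_const_lt (by rw [h0]; linarith)
  obtain ⟨δ, hδ, h⟩ := Metric.eventually_nhds_iff.1 hev
  refine ⟨min δ 1, ‖besselCoeff p 0‖ / 2, by positivity, min_le_right _ _, by positivity,
    fun r x hr hrδ hx => ?_⟩
  rw [norm_greenKer_eq p hr]
  refine div_le_div_of_nonneg_right ?_ (by positivity)
  have h1 := @h (r * x) (by
    rw [dist_zero_right, norm_mul, Real.norm_eq_abs, Real.norm_eq_abs, abs_of_nonneg hr]
    calc r * |x| ≤ r := by nlinarith
      _ < δ := hrδ.trans_le (min_le_left _ _))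
  push_cast at h1
  simp only [← mul_assoc] at h1
  exact h1.le

lemma omg_anti {p : ℕ} {δ r : ℝ} (hδ : 0 < δ) (h : δ ≤ r) : omg p r ≤ omg p δ := by
  have hr : 0 < r := hδ.trans_le h
  unfold omg
  rw [div_le_div_iff₀ (by positivity) (by positivity)]
  have h1 : (1 + r) * δ ≤ (1 + δ) * r := by nlinarith
  calc (1 + r) ^ p * δ ^ (2 * p + 1) = ((1 + r) * δ) ^ p * δ ^ (p + 1) := by
        rw [mul_pow]; ring
    _ ≤ ((1 + δ) * r) ^ p * r ^ (p + 1) := by gcongr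
    _ = _ := by rw [mul_pow]; ring

/-- Products of resolvent kernels at two frequencies are comparable up to the edge sum. -/
lemma exists_norm_prod_greenKer_le (p N : ℕ) : ∃ C : ℝ, 0 ≤ C ∧ ∀ r : ℕ → ℝ, (∀ i < N, 0 ≤ r i) →
    ∀ x x₀ : ℝ, |x| ≤ 1 → |x₀| ≤ 1 → ‖∏ i ∈ range N, greenKer p (r i) x‖ ≤
      C * (‖∏ i ∈ range N, greenKer p (r i) x₀‖ + edgeSum (fun i => omg p (r i)) N) := by
  obtain ⟨C, hC, hup⟩ := exists_norm_greenKer_le p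
  obtain ⟨δ, c, hδ, hδ1, hc, hlow⟩ := exists_norm_greenKer_ge p
  have hω0 := omg_nonneg p hδ.le
  refine ⟨(C * 2 ^ p / c) ^ N + C ^ N * omg p δ, by positivity, fun r hr x x₀ hx hx₀ => ?_⟩
  have hω : ∀ i < N, 0 ≤ omg p (r i) := fun i hi => omg_nonneg p (hr i hi)
  have hW := edgeSum_nonneg N hω
  by_cases hsmall : ∀ i < N, r i < δ
  · have hfac : ∀ i ∈ range N, ‖greenKer p (r i) x‖ ≤ C * 2 ^ p / c * ‖greenKer p (r i) x₀‖ := by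
      intro i hi
      have hi' := mem_range.1 hi
      have h1 := hup (r i) x (hr i hi') hx
      have h2 := hlow (r i) x₀ (hr i hi') (hsmall i hi') hx₀
      have h3 : omg p (r i) ≤ 2 ^ p / r i ^ (2 * p + 1) := by
        unfold omg
        have := hr i hi'
        have := hsmall i hi'
        gcongr
        linarith
      calc _ ≤ C * (2 ^ p / r i ^ (2 * p + 1)) := h1.trans (by gcongr)
        _ = C * 2 ^ p / c * (c / r i ^ (2 * p + 1)) := by field_simp
        _ ≤ _ := by gcongr
    rw [norm_prod, norm_prod]
    have h4 := prod_le_prod (fun i _ => norm_nonneg (greenKer p (r i) x)) hfac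
    rw [prod_mul_distrib, prod_const, card_range] at h4
    have h5 : 0 ≤ ∏ i ∈ range N, ‖greenKer p (r i) x₀‖ := prod_nonneg fun _ _ => norm_nonneg _
    have a1 : 0 ≤ (C * 2 ^ p / c) ^ N := by positivity
    have a2 : 0 ≤ C ^ N * omg p δ := by positivity
    nlinarith [mul_nonneg a1 hW, mul_nonneg a2 h5, mul_nonneg a2 hW]
  · push Not at hsmall
    obtain ⟨l, hl, hlδ⟩ := hsmall
    have h4 : ‖∏ i ∈ range N, greenKer p (r i) x‖ ≤ C ^ N * ∏ i ∈ range N, omg p (r i) := by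
      rw [norm_prod]
      have := prod_le_prod (fun i _ => norm_nonneg (greenKer p (r i) x))
        fun i hi => hup (r i) x (hr i (mem_range.1 hi)) hx
      rwa [prod_mul_distrib, prod_const, card_range] at this
    have h5 : ∏ i ∈ range N, omg p (r i) ≤ omg p δ * edgeSum (fun i => omg p (r i)) N := by
      rw [← mul_prod_erase _ _ (mem_range.2 hl)]
      have a2 := prod_erase_le_edgeSum (w := fun i => omg p (r i)) hω hl
      have a3 : 0 ≤ ∏ i ∈ (range N).erase l, omg p (r i) :=
        prod_nonneg fun i hi => hω i (mem_range.1 (mem_of_mem_erase hi))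
      have a4 := omg_anti (p := p) hδ hlδ
      gcongr
    have h6 := mul_le_mul_of_nonneg_left h5 (pow_nonneg hC N)
    have h7 := norm_nonneg (∏ i ∈ range N, greenKer p (r i) x₀)
    have a1 : 0 ≤ (C * 2 ^ p / c) ^ N := by positivity
    have a2 : 0 ≤ C ^ N * omg p δ := by positivity
    nlinarith [mul_nonneg a1 hW, mul_nonneg a1 h7, mul_nonneg a2 h7]

lemma Measurable.greenKer {α : Type*} [MeasurableSpace α] (p : ℕ) {g h : α → ℝ}
    (hg : Measurable g) (hh : Measurable h) : Measurable fun a => greenKer p (g a) (h a) := by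
  unfold _root_.greenKer
  fun_prop

section Weights

variable {p k : ℕ}

/-- The polynomial decay weight `(1 + ‖z‖)^{-(p+3)}`. -/
noncomputable def decay (p : ℕ) (z : EuclideanSpace ℝ (Fin (2 * p + 3))) : ℝ :=
  ((1 + ‖z‖) ^ (p + 3))⁻¹

/-- The length of the `j`-th edge of the chain `x, z₁, …, z_k, y`. -/
noncomputable def edgeLen {n k : ℕ} (x y : EuclideanSpace ℝ (Fin n))
    (z : Fin k → EuclideanSpace ℝ (Fin n)) (j : ℕ) : ℝ :=
  ‖chainPt x y z j - chainPt x y z (j + 1)‖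

lemma edgeLen_nonneg {n k : ℕ} (x y : EuclideanSpace ℝ (Fin n))
    (z : Fin k → EuclideanSpace ℝ (Fin n)) (j : ℕ) : 0 ≤ edgeLen x y z j := norm_nonneg _

lemma decay_pos (z : EuclideanSpace ℝ (Fin (2 * p + 3))) : 0 < decay p z := by
  unfold decay; positivity

lemma measurable_decay (p : ℕ) : Measurable (decay p) := by unfold decay; fun_prop

lemma measurable_edgeLen {n k : ℕ} (x y : EuclideanSpace ℝ (Fin n)) (j : ℕ) :
    Measurable fun z : Fin k → EuclideanSpace ℝ (Fin n) => edgeLen x y z j :=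
  ((measurable_chainPt measurable_const measurable_const measurable_id j).sub
    (measurable_chainPt measurable_const measurable_const measurable_id (j + 1))).norm

lemma measurable_ofReal_omg (p : ℕ) : Measurable (Function.uncurry
    fun a b : EuclideanSpace ℝ (Fin (2 * p + 3)) => ENNReal.ofReal (omg p ‖a - b‖)) :=
  ((measurable_omg p).comp (measurable_fst.sub measurable_snd).norm).ennreal_ofReal

lemma ofReal_chainProd (s : Finset ℕ) (x y : EuclideanSpace ℝ (Fin (2 * p + 3)))
    (z : Fin k → EuclideanSpace ℝ (Fin (2 * p + 3))) :
    ENNReal.ofReal ((∏ i ∈ s, omg p (edgeLen x y z i)) * ∏ j, decay p (z j)) =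
      (∏ i ∈ s, ENNReal.ofReal (omg p ‖chainPt x y z i - chainPt x y z (i + 1)‖)) *
        ∏ j, ENNReal.ofReal (decay p (z j)) := by
  rw [ENNReal.ofReal_mul (prod_nonneg fun _ _ => omg_nonneg p (edgeLen_nonneg _ _ _ _)),
    ENNReal.ofReal_prod_of_nonneg fun _ _ => omg_nonneg p (edgeLen_nonneg _ _ _ _),
    ENNReal.ofReal_prod_of_nonneg fun _ _ => (decay_pos _).le]
  rfl

lemma measurable_edgeSum_mul (p k : ℕ) (x y : EuclideanSpace ℝ (Fin (2 * p + 3))) :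
    Measurable fun z : Fin k → EuclideanSpace ℝ (Fin (2 * p + 3)) =>
      edgeSum (fun j => omg p (edgeLen x y z j)) (k + 1) * ∏ j, decay p (z j) := by
  refine Measurable.mul ?_ (Finset.measurable_fun_prod _ fun j _ =>
    (measurable_decay p).comp (measurable_pi_apply j))
  unfold edgeSum
  exact Finset.measurable_fun_sum _ fun l _ => Finset.measurable_fun_prod _ fun i _ =>
    (measurable_omg p).comp (measurable_edgeLen x y i)

lemma edgeSum_mul_nonneg (x y : EuclideanSpace ℝ (Fin (2 * p + 3)))
    (z : Fin k → EuclideanSpace ℝ (Fin (2 * p + 3))) :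
    0 ≤ edgeSum (fun j => omg p (edgeLen x y z j)) (k + 1) * ∏ j, decay p (z j) :=
  mul_nonneg (edgeSum_nonneg _ fun _ _ => omg_nonneg p (edgeLen_nonneg _ _ _ _))
    (prod_nonneg fun _ _ => (decay_pos _).le)

/-- The edge sum of a chain is integrable against the decay weights, uniformly in the
endpoints. -/
lemma exists_integral_edgeSum_le (p k : ℕ) : ∃ M : ℝ, 0 ≤ M ∧
    ∀ x y : EuclideanSpace ℝ (Fin (2 * p + 3)),
      Integrable (fun z : Fin k → EuclideanSpace ℝ (Fin (2 * p + 3)) =>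
        edgeSum (fun j => omg p (edgeLen x y z j)) (k + 1) * ∏ j, decay p (z j)) ∧
      ∫ z : Fin k → EuclideanSpace ℝ (Fin (2 * p + 3)),
        edgeSum (fun j => omg p (edgeLen x y z j)) (k + 1) * ∏ j, decay p (z j) ≤ M := by
  obtain ⟨κ, hκ, hb⟩ := exists_lintegral_omg_le p
  have hw := measurable_ofReal_omg p
  have hv : Measurable fun z => ENNReal.ofReal (decay p z) := (measurable_decay p).ennreal_ofReal
  have hb' : ∀ x : EuclideanSpace ℝ (Fin (2 * p + 3)),
      ∫⁻ z, ENNReal.ofReal (omg p ‖z - x‖) * ENNReal.ofReal (decay p z) ≤ κ := fun x => by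
    simpa only [norm_sub_rev, decay] using hb x
  have htop : ((k + 1 : ℕ) : ENNReal) * κ ^ k ≠ ⊤ :=
    ENNReal.mul_ne_top (ENNReal.natCast_ne_top _) (ENNReal.pow_ne_top hκ)
  have key : ∀ x y : EuclideanSpace ℝ (Fin (2 * p + 3)),
      ∫⁻ z : Fin k → EuclideanSpace ℝ (Fin (2 * p + 3)),
        ENNReal.ofReal (edgeSum (fun j => omg p (edgeLen x y z j)) (k + 1) *
          ∏ j, decay p (z j)) ≤ ((k + 1 : ℕ) : ENNReal) * κ ^ k := by
    intro x y
    have e : ∀ z : Fin k → EuclideanSpace ℝ (Fin (2 * p + 3)),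
        ENNReal.ofReal (edgeSum (fun j => omg p (edgeLen x y z j)) (k + 1) *
          ∏ j, decay p (z j)) = ∑ l ∈ range (k + 1), ((∏ i ∈ (range (k + 1)).erase l,
            ENNReal.ofReal (omg p ‖chainPt x y z i - chainPt x y z (i + 1)‖)) *
              ∏ j, ENNReal.ofReal (decay p (z j))) := by
      intro z
      rw [edgeSum, sum_mul, ENNReal.ofReal_sum_of_nonneg]
      · exact sum_congr rfl fun l _ => ofReal_chainProd _ x y z
      · exact fun l _ => mul_nonneg (prod_nonneg fun i _ => omg_nonneg p (edgeLen_nonneg _ _ _ _))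
          (prod_nonneg fun j _ => (decay_pos _).le)
    simp only [e]
    rw [lintegral_finsetSum _ fun l _ => measurable_chainProd_const _ hw hv x y]
    refine (sum_le_sum fun l hl => lintegral_chain_erase_le hw hv hb hb' k l
      (by simpa using hl) x y).trans ?_
    simp
  refine ⟨(((k + 1 : ℕ) : ENNReal) * κ ^ k).toReal, ENNReal.toReal_nonneg, fun x y => ⟨?_, ?_⟩⟩
  · rw [← lintegral_ofReal_ne_top_iff_integrable
      (measurable_edgeSum_mul p k x y).aestronglyMeasurable
      (Filter.Eventually.of_forall (edgeSum_mul_nonneg x y))]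
    exact ((key x y).trans_lt htop.lt_top).ne
  · rw [integral_eq_lintegral_of_nonneg_ae (Filter.Eventually.of_forall (edgeSum_mul_nonneg x y))
      (measurable_edgeSum_mul p k x y).aestronglyMeasurable]
    exact ENNReal.toReal_mono htop (key x y)

/-- For almost every pair of endpoints the full chain weight is integrable. -/
lemma ae_integrable_chain (p k : ℕ) :
    ∀ᵐ q : EuclideanSpace ℝ (Fin (2 * p + 3)) × EuclideanSpace ℝ (Fin (2 * p + 3)),
      Integrable (fun z : Fin k → EuclideanSpace ℝ (Fin (2 * p + 3)) =>
        (∏ i ∈ range (k + 1), omg p (edgeLen q.1 q.2 z i)) * ∏ j, decay p (z j)) := by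
  obtain ⟨κ, hκ, hb⟩ := exists_lintegral_omg_le p
  have hw := measurable_ofReal_omg p
  have hv : Measurable fun z => ENNReal.ofReal (decay p z) := (measurable_decay p).ennreal_ofReal
  have hb' : ∀ x : EuclideanSpace ℝ (Fin (2 * p + 3)),
      ∫⁻ z, ENNReal.ofReal (omg p ‖z - x‖) * ENNReal.ofReal (decay p z) ≤ κ := fun x => by
    simpa only [norm_sub_rev, decay] using hb x
  set H : EuclideanSpace ℝ (Fin (2 * p + 3)) × EuclideanSpace ℝ (Fin (2 * p + 3)) → ENNReal :=
    fun q => ∫⁻ z : Fin k → EuclideanSpace ℝ (Fin (2 * p + 3)), (∏ i ∈ range (k + 1),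
      ENNReal.ofReal (omg p ‖chainPt q.1 q.2 z i - chainPt q.1 q.2 z (i + 1)‖)) *
        ∏ j, ENNReal.ofReal (decay p (z j)) with hH
  have hHm : Measurable H :=
    (measurable_chainProd (range (k + 1)) hw hv (measurable_fst.comp measurable_fst)
      (measurable_snd.comp measurable_fst) measurable_snd).lintegral_prod_right'
  have hfin : ∀ᵐ q, H q ≠ ⊤ := by
    have hs : MeasurableSet {q | ¬ H q ≠ ⊤} := by
      simp only [ne_eq, not_not]
      exact hHm (measurableSet_singleton _)
    rw [ae_iff, Measure.volume_eq_prod, Measure.measure_prod_null hs]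
    refine Filter.Eventually.of_forall fun x => ?_
    have h1 := lintegral_chain_le hw hv hb hb' k x
    have h2 : ∀ᵐ y, ENNReal.ofReal (decay p y) * H (x, y) < ⊤ :=
      ae_lt_top (hv.mul (hHm.comp measurable_prodMk_left))
        (h1.trans_lt (ENNReal.pow_ne_top hκ).lt_top).ne
    have h3 : ∀ᵐ y, H (x, y) ≠ ⊤ := h2.mono fun y hy h => by
      rw [h, ENNReal.mul_top (by simpa using decay_pos y)] at hy
      exact lt_irrefl _ hy
    exact ae_iff.1 h3
  refine hfin.mono fun q hq => ?_
  rw [← lintegral_ofReal_ne_top_iff_integrable]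
  · simpa only [ofReal_chainProd] using hq
  · refine Measurable.aestronglyMeasurable (Measurable.mul ?_ (Finset.measurable_fun_prod _
      fun j _ => (measurable_decay p).comp (measurable_pi_apply j)))
    exact Finset.measurable_fun_prod _ fun i _ =>
      (measurable_omg p).comp (measurable_edgeLen q.1 q.2 i)
  · exact Filter.Eventually.of_forall fun z =>
      mul_nonneg (prod_nonneg fun i _ => omg_nonneg p (edgeLen_nonneg _ _ _ _))
        (prod_nonneg fun j _ => (decay_pos _).le)

end Weights

section Born

variable {p k : ℕ} {V : EuclideanSpace ℝ (Fin (2 * p + 3)) → ℝ} {C₀ : ℝ}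

lemma bornIntegrand_eq (V : EuclideanSpace ℝ (Fin (2 * p + 3)) → ℝ) (lam : ℝ)
    (x y : EuclideanSpace ℝ (Fin (2 * p + 3)))
    (z : Fin k → EuclideanSpace ℝ (Fin (2 * p + 3))) :
    bornIntegrand (2 * p + 3) k V lam x y z =
      (∏ i ∈ range (k + 1), greenKer p (edgeLen x y z i) lam) *
        ((resC (2 * p + 3) : ℂ) ^ (k + 1) * ∏ j, (V (z j) : ℂ)) := by
  simp only [bornIntegrand, gker_eq, prod_mul_distrib, prod_const, card_range, edgeLen]
  ring

lemma norm_potential_le (hV : ∀ z, |V z| ≤ C₀ * decay p z)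
    (z : Fin k → EuclideanSpace ℝ (Fin (2 * p + 3))) :
    ‖(resC (2 * p + 3) : ℂ) ^ (k + 1) * ∏ j, (V (z j) : ℂ)‖ ≤
      |resC (2 * p + 3)| ^ (k + 1) * C₀ ^ k * ∏ j, decay p (z j) := by
  rw [norm_mul, norm_pow, norm_prod, Complex.norm_real, Real.norm_eq_abs, mul_assoc]
  refine mul_le_mul_of_nonneg_left ?_ (by positivity)
  have h := prod_le_prod (s := (univ : Finset (Fin k))) (fun j _ => norm_nonneg (V (z j) : ℂ))
    (fun j _ => (by simpa using hV (z j) : ‖(V (z j) : ℂ)‖ ≤ C₀ * decay p (z j)))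
  rwa [prod_mul_distrib, prod_const, card_univ, Fintype.card_fin] at h

lemma measurable_prod_greenKer (x y : EuclideanSpace ℝ (Fin (2 * p + 3))) :
    Measurable fun q : ℝ × (Fin k → EuclideanSpace ℝ (Fin (2 * p + 3))) =>
      ∏ i ∈ range (k + 1), greenKer p (edgeLen x y q.2 i) q.1 :=
  Finset.measurable_fun_prod _ fun i _ =>
    ((measurable_edgeLen x y i).comp measurable_snd).greenKer p measurable_fst

lemma measurable_potential (hVm : Measurable V) :
    Measurable fun z : Fin k → EuclideanSpace ℝ (Fin (2 * p + 3)) =>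
      (resC (2 * p + 3) : ℂ) ^ (k + 1) * ∏ j, (V (z j) : ℂ) :=
  (Finset.measurable_fun_prod _ fun j _ =>
    (hVm.comp (measurable_pi_apply j)).complex_ofReal).const_mul _

lemma measurable_bornIntegrand (hVm : Measurable V) (lam : ℝ)
    (x y : EuclideanSpace ℝ (Fin (2 * p + 3))) :
    Measurable (bornIntegrand (2 * p + 3) k V lam x y) := by
  have h := ((measurable_prod_greenKer (k := k) x y).comp
    (measurable_prodMk_left (x := lam))).mul (measurable_potential hVm)
  exact (congrArg Measurable (funext fun z => (bornIntegrand_eq V lam x y z).symm)).mp h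

lemma integrable_bornIntegrand_of_chain (hVm : Measurable V)
    (hV : ∀ z, |V z| ≤ C₀ * decay p z) {x y : EuclideanSpace ℝ (Fin (2 * p + 3))}
    (h : Integrable (fun z : Fin k → EuclideanSpace ℝ (Fin (2 * p + 3)) =>
        (∏ i ∈ range (k + 1), omg p (edgeLen x y z i)) * ∏ j, decay p (z j)))
    {lam : ℝ} (hlam : |lam| ≤ 1) : Integrable (bornIntegrand (2 * p + 3) k V lam x y) := by
  obtain ⟨C, hC, hup⟩ := exists_norm_greenKer_le p
  refine (h.const_mul (C ^ (k + 1) * (|resC (2 * p + 3)| ^ (k + 1) * C₀ ^ k))).mono'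
    (measurable_bornIntegrand hVm lam x y).aestronglyMeasurable
    (Filter.Eventually.of_forall fun z => ?_)
  rw [bornIntegrand_eq, norm_mul, norm_prod]
  have h1 := prod_le_prod (fun i _ => norm_nonneg (greenKer p (edgeLen x y z i) lam))
    fun i (_ : i ∈ range (k + 1)) => hup (edgeLen x y z i) lam (edgeLen_nonneg _ _ _ _) hlam
  rw [prod_mul_distrib, prod_const, card_range] at h1
  calc _ ≤ (C ^ (k + 1) * ∏ i ∈ range (k + 1), omg p (edgeLen x y z i)) *
        (|resC (2 * p + 3)| ^ (k + 1) * C₀ ^ k * ∏ j, decay p (z j)) :=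
        mul_le_mul h1 (norm_potential_le hV z) (norm_nonneg _)
          ((prod_nonneg fun _ _ => norm_nonneg _).trans h1)
    _ = _ := by ring

lemma nonneg_of_abs_le_decay (hV : ∀ z, |V z| ≤ C₀ * decay p z) : 0 ≤ C₀ :=
  nonneg_of_mul_nonneg_left ((abs_nonneg _).trans (hV 0)) (decay_pos 0)

/-- The Born integrands at different frequencies are comparable, uniformly, up to an
integrable error. -/
lemma exists_norm_bornIntegrand_le (k : ℕ) (hV : ∀ z, |V z| ≤ C₀ * decay p z) :
    ∃ C B : ℝ, 0 ≤ C ∧ 0 ≤ B ∧ ∀ (x y : EuclideanSpace ℝ (Fin (2 * p + 3)))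
      (z : Fin k → EuclideanSpace ℝ (Fin (2 * p + 3))) (lam lam₀ : ℝ), |lam| ≤ 1 → |lam₀| ≤ 1 →
      ‖bornIntegrand (2 * p + 3) k V lam x y z‖ ≤
        C * (‖bornIntegrand (2 * p + 3) k V lam₀ x y z‖ +
          B * (edgeSum (fun j => omg p (edgeLen x y z j)) (k + 1) * ∏ j, decay p (z j))) := by
  obtain ⟨C, hC, h⟩ := exists_norm_prod_greenKer_le p (k + 1)
  have hC₀ := nonneg_of_abs_le_decay hV
  refine ⟨C, |resC (2 * p + 3)| ^ (k + 1) * C₀ ^ k, hC, by positivity,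
    fun x y z lam lam₀ hl hl₀ => ?_⟩
  have h1 := h (edgeLen x y z) (fun i _ => edgeLen_nonneg _ _ _ _) lam lam₀ hl hl₀
  have hW : 0 ≤ edgeSum (fun j => omg p (edgeLen x y z j)) (k + 1) :=
    edgeSum_nonneg _ fun i _ => omg_nonneg p (edgeLen_nonneg _ _ _ _)
  have h2 := norm_potential_le hV z
  rw [bornIntegrand_eq, bornIntegrand_eq, norm_mul _ (_ * _), norm_mul _ (_ * _)]
  set U := ‖(resC (2 * p + 3) : ℂ) ^ (k + 1) * ∏ j, (V (z j) : ℂ)‖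
  have hU : 0 ≤ U := norm_nonneg _
  calc _ ≤ C * (‖∏ i ∈ range (k + 1), greenKer p (edgeLen x y z i) lam₀‖ +
          edgeSum (fun j => omg p (edgeLen x y z j)) (k + 1)) * U := by gcongr
    _ = C * (‖∏ i ∈ range (k + 1), greenKer p (edgeLen x y z i) lam₀‖ * U +
          edgeSum (fun j => omg p (edgeLen x y z j)) (k + 1) * U) := by ring
    _ ≤ C * (‖∏ i ∈ range (k + 1), greenKer p (edgeLen x y z i) lam₀‖ * U +
          edgeSum (fun j => omg p (edgeLen x y z j)) (k + 1) *
            (|resC (2 * p + 3)| ^ (k + 1) * C₀ ^ k * ∏ j, decay p (z j))) := by gcongr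
    _ = _ := by ring

lemma integrable_bornIntegrand_of_integrable (hVm : Measurable V)
    (hV : ∀ z, |V z| ≤ C₀ * decay p z) {x y : EuclideanSpace ℝ (Fin (2 * p + 3))} {lam lam₀ : ℝ}
    (hlam : |lam| ≤ 1) (hlam₀ : |lam₀| ≤ 1)
    (h : Integrable (bornIntegrand (2 * p + 3) k V lam₀ x y)) :
    Integrable (bornIntegrand (2 * p + 3) k V lam x y) := by
  obtain ⟨C, B, -, -, hle⟩ := exists_norm_bornIntegrand_le k hV
  obtain ⟨M, -, hM⟩ := exists_integral_edgeSum_le p k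
  exact ((h.norm.add ((hM x y).1.const_mul B)).const_mul C).mono'
    (measurable_bornIntegrand hVm lam x y).aestronglyMeasurable
    (Filter.Eventually.of_forall fun z => hle x y z lam lam₀ hlam hlam₀)

variable {f : ℝ → ℂ} {b : ℝ}

/-- Interchange of the spectral integral and the spatial integrals. -/
lemma integral_bornKernel_sub (hVm : Measurable V) (hV : ∀ z, |V z| ≤ C₀ * decay p z)
    (hf : Continuous f) (hb : b ≤ 1) (hfb : ∀ s, b < s → f s = 0) (t : ℝ)
    {x y : EuclideanSpace ℝ (Fin (2 * p + 3))}
    (h : Integrable (bornIntegrand (2 * p + 3) k V 1 x y)) :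
    ∫ s in (0 : ℝ)..2, cexp (I * t * (s : ℂ) ^ 2) * s * f s *
        (bornKernel (2 * p + 3) k V s x y - bornKernel (2 * p + 3) k V (-s) x y) =
      ∫ z : Fin k → EuclideanSpace ℝ (Fin (2 * p + 3)),
        (∫ s in (0 : ℝ)..2, cexp (I * t * (s : ℂ) ^ 2) * (s * (f s *
          (∏ i ∈ range (k + 1), greenKer p (edgeLen x y z i) s -
            ∏ i ∈ range (k + 1), greenKer p (edgeLen x y z i) (-s))))) *
          ((resC (2 * p + 3) : ℂ) ^ (k + 1) * ∏ j, (V (z j) : ℂ)) := by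
  set Q : ℝ → (Fin k → EuclideanSpace ℝ (Fin (2 * p + 3))) → ℂ := fun s z =>
    ∏ i ∈ range (k + 1), greenKer p (edgeLen x y z i) s with hQ
  set U : (Fin k → EuclideanSpace ℝ (Fin (2 * p + 3))) → ℂ := fun z =>
    (resC (2 * p + 3) : ℂ) ^ (k + 1) * ∏ j, (V (z j) : ℂ) with hU
  have hB : ∀ s z, bornIntegrand (2 * p + 3) k V s x y z = Q s z * U z := fun s z =>
    bornIntegrand_eq V s x y z
  have m1 : Measurable fun q : ℝ × (Fin k → EuclideanSpace ℝ (Fin (2 * p + 3))) =>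
      Q q.1 q.2 := measurable_prod_greenKer x y
  have m3 : Measurable fun q : ℝ × (Fin k → EuclideanSpace ℝ (Fin (2 * p + 3))) => U q.2 :=
      (measurable_potential hVm).comp measurable_snd
  clear_value Q U
  set Φ : ℝ → (Fin k → EuclideanSpace ℝ (Fin (2 * p + 3))) → ℂ := fun s z =>
    cexp (I * t * (s : ℂ) ^ 2) * (s * (f s * (Q s z - Q (-s) z))) * U z with hΦ
  have hΦ' : ∀ s z, Φ s z = cexp (I * t * (s : ℂ) ^ 2) * s * f s *
      (bornIntegrand (2 * p + 3) k V s x y z - bornIntegrand (2 * p + 3) k V (-s) x y z) := by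
    intro s z
    rw [hB, hB]
    simp only [hΦ]
    ring
  obtain ⟨C, B, hC, hB0, hle⟩ := exists_norm_bornIntegrand_le k hV
  obtain ⟨M, -, hM⟩ := exists_integral_edgeSum_le p k
  obtain ⟨F, hF⟩ := (isCompact_Icc (a := (0 : ℝ)) (b := 2)).exists_bound_of_continuousOn
    hf.continuousOn
  have hF0 : 0 ≤ F := (norm_nonneg _).trans (hF 0 (by simp))
  set G : (Fin k → EuclideanSpace ℝ (Fin (2 * p + 3))) → ℝ := fun z =>
    C * (‖bornIntegrand (2 * p + 3) k V 1 x y z‖ +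
      B * (edgeSum (fun j => omg p (edgeLen x y z j)) (k + 1) * ∏ j, decay p (z j))) with hG
  have hGi : Integrable G := (h.norm.add ((hM x y).1.const_mul B)).const_mul C
  have hG0 : ∀ z, 0 ≤ G z := fun z => (norm_nonneg _).trans (hle x y z 1 1 (by simp) (by simp))
  have hbd : ∀ s ∈ Set.Ioc (0 : ℝ) 2, ∀ z, ‖Φ s z‖ ≤ 2 * F * (2 * G z) := by
    intro s hs z
    have := hG0 z
    by_cases hs1 : s ≤ 1
    · have a : |s| ≤ 1 := abs_le.2 ⟨by linarith [hs.1], hs1⟩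
      have e : ‖cexp (I * t * (s : ℂ) ^ 2)‖ = 1 := by
        rw [show I * t * (s : ℂ) ^ 2 = ((t * s ^ 2 : ℝ) : ℂ) * I by push_cast; ring,
          Complex.norm_exp_ofReal_mul_I]
      rw [hΦ', norm_mul, norm_mul, norm_mul, e, one_mul, Complex.norm_real, Real.norm_eq_abs,
        abs_of_pos hs.1]
      have h1 := hle x y z s 1 a (by simp)
      have h2 := hle x y z (-s) 1 (by rwa [abs_neg]) (by simp)
      have h3 := norm_sub_le (bornIntegrand (2 * p + 3) k V s x y z)
        (bornIntegrand (2 * p + 3) k V (-s) x y z)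
      exact mul_le_mul (mul_le_mul hs.2 (hF s ⟨hs.1.le, hs.2⟩) (norm_nonneg _) (by norm_num))
        (by simp only [hG]; linarith) (norm_nonneg _) (by positivity)
    · have : Φ s z = 0 := by
        simp only [hΦ, hfb s (by linarith [not_le.1 hs1])]
        ring
      rw [this, norm_zero]
      positivity
  have hΦm : Measurable (Function.uncurry Φ) := by
    have m2 : Measurable fun q : ℝ × (Fin k → EuclideanSpace ℝ (Fin (2 * p + 3))) =>
      Q (-q.1) q.2 := m1.comp (measurable_fst.neg.prodMk measurable_snd)
    have m4 : Measurable fun s : ℝ => cexp (I * t * (s : ℂ) ^ 2) := by fun_prop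
    have m5 : Measurable fun q : ℝ × (Fin k → EuclideanSpace ℝ (Fin (2 * p + 3))) =>
      (q.1 : ℂ) := by fun_prop
    exact ((m4.comp measurable_fst).mul
      (m5.mul ((hf.measurable.comp measurable_fst).mul (m1.sub m2)))).mul m3
  have hΦi : Integrable (Function.uncurry Φ)
      ((volume.restrict (Set.Ioc (0 : ℝ) 2)).prod volume) := by
    refine (((hGi.const_mul 2).const_mul (2 * F)).comp_snd
      (volume.restrict (Set.Ioc (0 : ℝ) 2))).mono' hΦm.aestronglyMeasurable ?_
    exact (Measure.quasiMeasurePreserving_fst.ae (ae_restrict_mem measurableSet_Ioc)).mono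
      fun q hq => hbd q.1 hq q.2
  rw [intervalIntegral.integral_of_le (by norm_num)]
  have e1 : ∫ s in Set.Ioc (0 : ℝ) 2, cexp (I * t * (s : ℂ) ^ 2) * s * f s *
        (bornKernel (2 * p + 3) k V s x y - bornKernel (2 * p + 3) k V (-s) x y) =
      ∫ s in Set.Ioc (0 : ℝ) 2, ∫ z, Φ s z := by
    refine setIntegral_congr_fun measurableSet_Ioc fun s hs => ?_
    simp only [hΦ']
    by_cases hs1 : s ≤ 1
    · have a : |s| ≤ 1 := abs_le.2 ⟨by linarith [hs.1], hs1⟩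
      rw [integral_const_mul, integral_sub
        (integrable_bornIntegrand_of_integrable hVm hV a (by simp) h)
        (integrable_bornIntegrand_of_integrable hVm hV (by rwa [abs_neg]) (by simp) h)]
      rfl
    · simp [hfb s (by linarith [not_le.1 hs1])]
  rw [e1, integral_integral_swap hΦi]
  refine integral_congr_ae (Filter.Eventually.of_forall fun z => ?_)
  simp only [hΦ]
  rw [integral_mul_const, intervalIntegral.integral_of_le (by norm_num), hQ, hU]

lemma norm_integral_bornKernel_le (k : ℕ) (hVm : Measurable V)
    (hV : ∀ z, |V z| ≤ C₀ * decay p z) {a : ℝ} (ha : 0 < a) (hf : ContDiff ℝ (⊤ : ℕ∞) f)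
    (hb : b ≤ 1) {c : ℂ} (hfa : ∀ s < a, f s = c) (hfb : ∀ s, b < s → f s = 0) :
    ∃ C : ℝ, 0 < C ∧ ∀ t : ℝ, t ≠ 0 → ∀ x y : EuclideanSpace ℝ (Fin (2 * p + 3)),
      ‖∫ s in (0 : ℝ)..2, cexp (I * t * (s : ℂ) ^ 2) * s * f s *
        (bornKernel (2 * p + 3) k V s x y - bornKernel (2 * p + 3) k V (-s) x y)‖ ≤
      C * |t| ^ (-(2 * ((p + 1 : ℕ) : ℝ) + 1) / 2) := by
  obtain ⟨C, hC, hJ⟩ := exists_norm_integral_greenKer_le p (k + 1) ha (hb.trans_lt one_lt_two)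
    hf hfa hfb
  obtain ⟨M, hM0, hM⟩ := exists_integral_edgeSum_le p k
  have hC₀ := nonneg_of_abs_le_decay hV
  set R := |resC (2 * p + 3)| ^ (k + 1) * C₀ ^ k with hR
  have hR0 : 0 ≤ R := by positivity
  refine ⟨C * R * M + 1, by positivity, fun t ht x y => ?_⟩
  set T := |t| ^ (-(2 * ((p + 1 : ℕ) : ℝ) + 1) / 2) with hT
  have hT0 : 0 ≤ T := Real.rpow_nonneg (abs_nonneg _) _
  by_cases h : Integrable (bornIntegrand (2 * p + 3) k V 1 x y)
  · rw [integral_bornKernel_sub hVm hV hf.continuous hb hfb t h]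
    have hpt : ∀ z : Fin k → EuclideanSpace ℝ (Fin (2 * p + 3)),
        ‖(∫ s in (0 : ℝ)..2, cexp (I * t * (s : ℂ) ^ 2) * (s * (f s *
          (∏ i ∈ range (k + 1), greenKer p (edgeLen x y z i) s -
            ∏ i ∈ range (k + 1), greenKer p (edgeLen x y z i) (-s))))) *
          ((resC (2 * p + 3) : ℂ) ^ (k + 1) * ∏ j, (V (z j) : ℂ))‖ ≤
        C * R * T * (edgeSum (fun j => omg p (edgeLen x y z j)) (k + 1) *
          ∏ j, decay p (z j)) := by
      intro z
      have hW : 0 ≤ edgeSum (fun j => omg p (edgeLen x y z j)) (k + 1) :=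
        edgeSum_nonneg _ fun i _ => omg_nonneg p (edgeLen_nonneg _ _ _ _)
      have hin : ‖∫ s in (0 : ℝ)..2, cexp (I * t * (s : ℂ) ^ 2) * (s * (f s *
          (∏ i ∈ range (k + 1), greenKer p (edgeLen x y z i) s -
            ∏ i ∈ range (k + 1), greenKer p (edgeLen x y z i) (-s))))‖ ≤
          C * edgeSum (fun j => omg p (edgeLen x y z j)) (k + 1) * T := by
        by_cases hpos : ∀ i < k + 1, 0 < edgeLen x y z i
        · exact hJ _ hpos t ht
        · push Not at hpos
          obtain ⟨l, hl, hl0⟩ := hpos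
          have hz : ∀ s, ∏ i ∈ range (k + 1), greenKer p (edgeLen x y z i) s = 0 := fun s =>
            prod_eq_zero (mem_range.2 hl)
              (by rw [le_antisymm hl0 (edgeLen_nonneg _ _ _ _), greenKer_zero_left])
          simp only [hz, sub_self, mul_zero, intervalIntegral.integral_zero, norm_zero]
          positivity
      rw [norm_mul]
      calc _ ≤ C * edgeSum (fun j => omg p (edgeLen x y z j)) (k + 1) * T *
            (R * ∏ j, decay p (z j)) :=
            mul_le_mul hin (norm_potential_le hV z) (norm_nonneg _) (by positivity)
        _ = _ := by ring
    refine (norm_integral_le_of_norm_le ((hM x y).1.const_mul (C * R * T))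
      (Filter.Eventually.of_forall hpt)).trans ?_
    rw [integral_const_mul]
    calc C * R * T * _ ≤ C * R * T * M := by
          have := (hM x y).2
          gcongr
      _ ≤ (C * R * M + 1) * T := by linarith
  · have hK : ∀ s : ℝ, |s| ≤ 1 → bornKernel (2 * p + 3) k V s x y = 0 := fun s hs =>
      integral_undef fun h' =>
        h (integrable_bornIntegrand_of_integrable hVm hV (by simp) hs h')
    have : ∫ s in (0 : ℝ)..2, cexp (I * t * (s : ℂ) ^ 2) * s * f s *
        (bornKernel (2 * p + 3) k V s x y - bornKernel (2 * p + 3) k V (-s) x y) =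
        ∫ s in (0 : ℝ)..2, (0 : ℂ) := by
      refine intervalIntegral.integral_congr fun s hs => ?_
      rw [Set.uIcc_of_le (by norm_num)] at hs
      by_cases hs1 : s ≤ 1
      · have a : |s| ≤ 1 := abs_le.2 ⟨by linarith [hs.1], hs1⟩
        simp [hK s a, hK (-s) (by rwa [abs_neg])]
      · simp [hfb s (by linarith [not_le.1 hs1])]
    rw [this, intervalIntegral.integral_zero, norm_zero]
    positivity

end Born

lemma rpow_le_decay {p : ℕ} {ε : ℝ} (hε : 0 < ε) (z : EuclideanSpace ℝ (Fin (2 * p + 3))) :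
    (1 + ‖z‖) ^ (-(((2 * p + 3 : ℕ) : ℝ) + 3) / 2 - ε) ≤ decay p z := by
  have h : (1 : ℝ) ≤ 1 + ‖z‖ := by linarith [norm_nonneg z]
  rw [decay, ← Real.rpow_natCast, ← Real.rpow_neg (by positivity)]
  refine Real.rpow_le_rpow_of_exponent_le h ?_
  push_cast
  linarith

/-- Lemma 4.3 of the paper: dispersive bound for the `k`-th term of the Born series,
`sup_{x,y} |∫₀^∞ e^{itλ²} λ χ(λ) [K_k^{+}(λ;x,y) − K_k^{−}(λ;x,y)] dλ| ≲ |t|^{−n/2}`,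
for potentials with `|V(x)| ≲ ⟨x⟩^{−(n+3)/2−ε}`. -/
theorem born_series_dispersive_bound (n : ℕ) (hn : 5 ≤ n) (hodd : Odd n)
    (k : ℕ) (hk : 1 ≤ k) (V : EuclideanSpace ℝ (Fin n) → ℝ) (hVmeas : Measurable V)
    (C₀ ε : ℝ) (hε : 0 < ε)
    (hV : ∀ x, |V x| ≤ C₀ * (1 + ‖x‖) ^ (-((n : ℝ) + 3) / 2 - ε))
    (lam1 : ℝ) (h0 : 0 < lam1) (h1 : lam1 ≤ 1)
    (χ : ℝ → ℝ) (hχ : ContDiff ℝ (⊤ : ℕ∞) χ)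
    (hχ1 : ∀ lam : ℝ, lam ≤ lam1 / 2 → χ lam = 1)
    (hχ0 : ∀ lam : ℝ, lam1 ≤ lam → χ lam = 0) :
    (∀ lam : ℝ, 0 < lam → lam ≤ 1 →
      ∀ᵐ p : EuclideanSpace ℝ (Fin n) × EuclideanSpace ℝ (Fin n),
        Integrable (bornIntegrand n k V lam p.1 p.2) ∧
        Integrable (bornIntegrand n k V (-lam) p.1 p.2)) ∧
    ∃ C : ℝ, 0 < C ∧ ∀ t : ℝ, t ≠ 0 → ∀ x y : EuclideanSpace ℝ (Fin n),
      ‖∫ lam in Set.Ioi (0 : ℝ),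
          Complex.exp (Complex.I * (t : ℂ) * (lam : ℂ) ^ 2) * (lam : ℂ) * (χ lam : ℂ) *
            (bornKernel n k V lam x y - bornKernel n k V (-lam) x y)‖ ≤
        C * |t| ^ (-(n : ℝ) / 2) := by

  obtain ⟨p, rfl⟩ : ∃ p, n = 2 * p + 3 := by
    obtain ⟨m, rfl⟩ := hodd
    exact ⟨m - 1, by omega⟩
  have hC₀ : 0 ≤ C₀ := nonneg_of_mul_nonneg_left ((abs_nonneg _).trans (hV 0))
    (Real.rpow_pos_of_pos (by positivity) _)
  have hVd : ∀ z, |V z| ≤ C₀ * decay p z := fun z =>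
    (hV z).trans (mul_le_mul_of_nonneg_left (rpow_le_decay hε z) hC₀)
  refine ⟨fun lam hl0 hl1 => (ae_integrable_chain p k).mono fun q hq => ?_, ?_⟩
  · have ha : |lam| ≤ 1 := abs_le.2 ⟨by linarith, hl1⟩
    exact ⟨integrable_bornIntegrand_of_chain hVmeas hVd hq ha,
      integrable_bornIntegrand_of_chain hVmeas hVd hq (by rwa [abs_neg])⟩
  · obtain ⟨C, hC, hle⟩ := norm_integral_bornKernel_le (f := fun s => (χ s : ℂ)) (c := 1) k
      hVmeas hVd (half_pos h0) (Complex.ofRealCLM.contDiff.comp hχ) h1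
      (fun s hs => by simp [hχ1 s hs.le]) (fun s hs => by simp [hχ0 s hs.le])
    refine ⟨C, hC, fun t ht x y => ?_⟩
    have e : -((2 * p + 3 : ℕ) : ℝ) / 2 = -(2 * ((p + 1 : ℕ) : ℝ) + 1) / 2 := by
      push_cast
      ring
    rw [e]
    convert hle t ht x y using 2
    rw [intervalIntegral.integral_of_le (by norm_num)]
    refine setIntegral_eq_of_subset_of_forall_sdiff_eq_zero measurableSet_Ioi
      Set.Ioc_subset_Ioi_self fun s hs => ?_
    have hs2 : lam1 ≤ s := by
      by_contra hlt
      exact hs.2 ⟨hs.1, by linarith [not_le.1 hlt]⟩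
    simp [hχ0 s hs2]
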